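/- arXiv:1402.0129 — 5 statements merged into one kernel-verified Lean document; each statement's English description precedes it below -/
import Mathlib

section
/- For any density matrix ρ, any d×d unitary matrix U relating two orthonormal bases, the induced probability vectors p and q, and any probability vector Q ∈ ℝ^{d²} sorted in decreasing order such that p⊗q ≺ Q, one has H(p) + H(q) ≥ −ln(Q·c) + S(ρ), where c ∈ ℝ^{d²} is the vector of the d² values |U_{ij}|² sorted in decreasing order and Q·c denotes the scalar product. (This is the bound B_RPZ1.) -/
open scoped BigOperators Matrix ComplexConjugate ComplexOrder

/-- Shannon entropy of a finite real vector (natural logarithm). -/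
noncomputable def shannonEntropy {n : Type*} [Fintype n] (x : n → ℝ) : ℝ :=
  -∑ i, x i * Real.log (x i)

/-- Von Neumann entropy of a Hermitian matrix, `-∑ λᵢ ln λᵢ`. -/
noncomputable def vonNeumannEntropy {d : ℕ} {ρ : Matrix (Fin d) (Fin d) ℂ}
    (hρ : ρ.IsHermitian) : ℝ :=
  -∑ i, hρ.eigenvalues i * Real.log (hρ.eigenvalues i)

/-- `Majorizes x y` means `x ≺ y`: the vectors have equal total sums and, for every `k`,
the sum of the `k` largest entries of `x` is at most the sum of the `k` largest entries
of `y` (formulated via subsets; the two index types may differ, which corresponds to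
padding the shorter vector with zeros). -/
def Majorizes {ι κ : Type*} [Fintype ι] [Fintype κ] (x : ι → ℝ) (y : κ → ℝ) : Prop :=
  (∑ i, x i = ∑ j, y j) ∧
  ∀ A : Finset ι, ∃ B : Finset κ, B.card ≤ A.card ∧ ∑ i ∈ A, x i ≤ ∑ j ∈ B, y j

open Set in
theorem continuousOn_sum_mul_log_add {ι : Type*} [Fintype ι] (v y : ι → ℝ)
    (hvy : ∀ i, v i ≠ 0 → 0 < y i) :
    ContinuousOn (fun t : ℝ => ∑ i, v i * Real.log (y i + t)) (Ici 0) := by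
  refine continuousOn_finsetSum _ fun i _ => ?_
  by_cases h : v i = 0
  · simpa [h] using continuousOn_const
  · refine continuousOn_const.mul (ContinuousOn.log (by fun_prop) fun t ht => ?_)
    have := hvy i h
    have ht : 0 ≤ t := ht
    positivity

theorem hasDerivAt_sum_mul_log_add {ι : Type*} [Fintype ι] (v y : ι → ℝ)
    (hy : ∀ i, 0 ≤ y i) {t : ℝ} (ht : 0 < t) :
    HasDerivAt (fun t : ℝ => ∑ i, v i * Real.log (y i + t)) (∑ i, v i / (y i + t)) t := by
  refine HasDerivAt.fun_sum fun i _ => ?_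
  have hne : y i + t ≠ 0 := by have := hy i; positivity
  simpa [div_eq_mul_inv] using (((hasDerivAt_id' t).const_add (y i)).log hne).const_mul (v i)

open Filter Topology in
theorem tendsto_sum_mul_log_add_sub {ι : Type*} [Fintype ι] (v y : ι → ℝ) :
    Tendsto (fun t : ℝ => ∑ i, v i * Real.log (y i + t) - (∑ i, v i) * Real.log t)
      atTop (𝓝 0) := by
  have h : ∀ i, Tendsto (fun t : ℝ => v i * (Real.log (y i + t) - Real.log t))
      atTop (𝓝 (v i * 0)) := by
    intro i
    refine Tendsto.const_mul _ ?_
    have := Real.tendsto_log_comp_add_sub_log (y i)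
    simpa [add_comm] using this
  have h2 := tendsto_finsetSum Finset.univ fun i _ => h i
  simpa [mul_sub, Finset.sum_sub_distrib, Finset.sum_mul] using h2

open Finset Filter Topology in
/-- Comparison of logarithmic averages from comparison of all resolvent averages. -/
theorem sum_mul_log_le_of_resolvent_le {ι κ : Type*} [Fintype ι] [Fintype κ]
    (w x : ι → ℝ) (q m : κ → ℝ)
    (hx : ∀ i, 0 ≤ x i) (hm : ∀ j, 0 ≤ m j)
    (hwx : ∀ i, w i ≠ 0 → 0 < x i) (hqm : ∀ j, q j ≠ 0 → 0 < m j)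
    (hsum : ∑ i, w i = ∑ j, q j)
    (hres : ∀ t : ℝ, 0 < t → ∑ j, q j / (m j + t) ≤ ∑ i, w i / (x i + t)) :
    ∑ i, w i * Real.log (x i) ≤ ∑ j, q j * Real.log (m j) := by
  set D : ℝ → ℝ := fun t =>
    ∑ i, w i * Real.log (x i + t) - ∑ j, q j * Real.log (m j + t) with hD
  have hmono : MonotoneOn D (Set.Ici 0) := by
    have hd : ∀ t : ℝ, 0 < t →
        HasDerivAt D (∑ i, w i / (x i + t) - ∑ j, q j / (m j + t)) t :=
      fun t ht => (hasDerivAt_sum_mul_log_add w x hx ht).sub (hasDerivAt_sum_mul_log_add q m hm ht)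
    refine monotoneOn_of_deriv_nonneg (convex_Ici 0)
      ((continuousOn_sum_mul_log_add w x hwx).sub (continuousOn_sum_mul_log_add q m hqm)) ?_ ?_
    · intro t ht
      rw [interior_Ici] at ht
      exact (hd t ht).differentiableAt.differentiableWithinAt
    · intro t ht
      rw [interior_Ici] at ht
      rw [(hd t ht).deriv]
      exact sub_nonneg.2 (hres t ht)
  have hDlim : Tendsto D atTop (𝓝 0) := by
    have := (tendsto_sum_mul_log_add_sub w x).sub (tendsto_sum_mul_log_add_sub q m)
    simp only [hsum, sub_self, sub_sub_sub_cancel_right] at this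
    exact this
  have h0 : D 0 ≤ 0 := by
    refine ge_of_tendsto hDlim ?_
    filter_upwards [eventually_ge_atTop 0] with t ht
    exact hmono Set.self_mem_Ici ht ht
  simpa [hD] using h0

/-- A unitary matrix preserves the sum of squared norms of each column. -/
theorem sum_norm_sq_unitary_mul {n : Type*} [Fintype n] [DecidableEq n]
    {V : Matrix n n ℂ} (hV : V ∈ Matrix.unitaryGroup n ℂ) (M : Matrix n n ℂ) (k : n) :
    ∑ i, ‖(V * M) i k‖ ^ 2 = ∑ j, ‖M j k‖ ^ 2 := by
  have key : ∀ N : Matrix n n ℂ, (((∑ i, ‖N i k‖ ^ 2 : ℝ)) : ℂ) = (Nᴴ * N) k k := by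
    intro N
    simp [Matrix.mul_apply, Complex.conj_mul']
  have h : Vᴴ * V = 1 := Matrix.mem_unitaryGroup_iff'.1 hV
  have : (V * M)ᴴ * (V * M) = Mᴴ * M := by
    rw [Matrix.conjTranspose_mul, Matrix.mul_assoc, ← Matrix.mul_assoc Vᴴ, h, Matrix.one_mul]
  exact_mod_cast (key _).trans (this ▸ (key M).symm)

/-- A unitary matrix preserves the sum of squared norms of each row. -/
theorem sum_norm_sq_mul_unitary {n : Type*} [Fintype n] [DecidableEq n]
    {V : Matrix n n ℂ} (hV : V ∈ Matrix.unitaryGroup n ℂ) (M : Matrix n n ℂ) (i : n) :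
    ∑ k, ‖(M * V) i k‖ ^ 2 = ∑ j, ‖M i j‖ ^ 2 := by
  have hV' : Vᴴ ∈ Matrix.unitaryGroup n ℂ := Unitary.star_mem hV
  have := sum_norm_sq_unitary_mul hV' Mᴴ i
  rw [← Matrix.conjTranspose_mul] at this
  simpa using this

theorem two_mul_re_sub_le_norm_sq_div (a u : ℂ) {y : ℝ} (hy : 0 < y) :
    2 * (star a * u).re - y * ‖u‖ ^ 2 ≤ ‖a‖ ^ 2 / y := by
  have h1 : (star a * u).re ≤ ‖a‖ * ‖u‖ := by
    calc (star a * u).re ≤ ‖star a * u‖ := Complex.re_le_norm _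
      _ = _ := by simp
  rw [le_div_iff₀ hy]
  nlinarith [sq_nonneg (‖a‖ - y * ‖u‖)]

/-- The resolvent form of monotonicity of relative entropy under a projective measurement. -/
theorem sum_resolvent_le {n : Type*} [Fintype n] [DecidableEq n] {U B : Matrix n n ℂ}
    (hU : U ∈ Matrix.unitaryGroup n ℂ) (hB : B ∈ Matrix.unitaryGroup n ℂ)
    (l p q r : n → ℝ) (hl : ∀ k, 0 ≤ l k) (hp0 : ∀ i, 0 ≤ p i)
    (hq : ∀ j, q j = ∑ k, l k * ‖B j k‖ ^ 2)
    (hr : ∀ j, r j = ∑ i, p i * ‖U i j‖ ^ 2) {t : ℝ} (ht : 0 < t) :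
    ∑ j, q j / (r j / q j + t) ≤
      ∑ ik : n × n, l ik.2 * ‖(U * B) ik.1 ik.2‖ ^ 2 / (p ik.1 / l ik.2 + t) := by
  have hq0 : ∀ j, 0 ≤ q j := fun j => hq j ▸ Finset.sum_nonneg fun k _ => by
    have := hl k; positivity
  have hr0 : ∀ j, 0 ≤ r j := fun j => hr j ▸ Finset.sum_nonneg fun k _ => by
    have := hp0 k; positivity
  set g : n → ℝ := fun j => q j / (r j + t * q j) with hg
  set G : Matrix n n ℂ := Matrix.diagonal fun j => (g j : ℂ) with hG
  set u : Matrix n n ℂ := U * (G * B) with hu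
  have hterm : ∀ ik : n × n,
      l ik.2 * (2 * (star ((U * B) ik.1 ik.2) * u ik.1 ik.2).re)
        - p ik.1 * ‖u ik.1 ik.2‖ ^ 2 - t * (l ik.2 * ‖u ik.1 ik.2‖ ^ 2) ≤
      l ik.2 * ‖(U * B) ik.1 ik.2‖ ^ 2 / (p ik.1 / l ik.2 + t) := by
    rintro ⟨i, k⟩
    have hy : 0 < p i / l k + t := by
      have := hl k; have := hp0 i; positivity
    have h := mul_le_mul_of_nonneg_left
      (two_mul_re_sub_le_norm_sq_div ((U * B) i k) (u i k) hy) (hl k)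
    have h2 : l k * (p i / l k) ≤ p i := by
      rcases (hl k).eq_or_lt with h | h
      · simp [← h, hp0 i]
      · rw [mul_div_cancel₀ _ h.ne']
    have h3 := mul_le_mul_of_nonneg_right h2 (sq_nonneg ‖u i k‖)
    rw [mul_div_assoc]
    nlinarith
  refine le_trans (le_of_eq ?_) (Finset.sum_le_sum fun ik _ => hterm ik)
  have h1 : ∑ ik : n × n, l ik.2 * (2 * (star ((U * B) ik.1 ik.2) * u ik.1 ik.2).re)
      = 2 * ∑ j, g j * q j := by
    have hUU : Uᴴ * U = 1 := Matrix.mem_unitaryGroup_iff'.1 hU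
    have hk : ∀ k, ∑ i, (star ((U * B) i k) * u i k).re = ∑ j, g j * ‖B j k‖ ^ 2 := by
      intro k
      have e1 : ∑ i, star ((U * B) i k) * u i k = ((U * B)ᴴ * u) k k := by
        rw [Matrix.mul_apply]; rfl
      have e2 : (U * B)ᴴ * u = Bᴴ * (G * B) := by
        rw [hu, Matrix.conjTranspose_mul, Matrix.mul_assoc, ← Matrix.mul_assoc Uᴴ, hUU,
          Matrix.one_mul]
      have e3 : (Bᴴ * (G * B)) k k = ((∑ j, g j * ‖B j k‖ ^ 2 : ℝ) : ℂ) := by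
        rw [Matrix.mul_apply]
        simp only [hG, Matrix.diagonal_mul, Matrix.conjTranspose_apply]
        push_cast
        refine Finset.sum_congr rfl fun j _ => ?_
        rw [← Complex.conj_mul', RCLike.star_def]; ring
      rw [← Complex.re_sum, e1, e2, e3, Complex.ofReal_re]
    rw [Fintype.sum_prod_type_right]
    simp only [← Finset.mul_sum, hk, hq]
    simp only [Finset.mul_sum]
    rw [Finset.sum_comm]
    refine Finset.sum_congr rfl fun j _ => Finset.sum_congr rfl fun k _ => by ring
  have h2 : ∑ ik : n × n, p ik.1 * ‖u ik.1 ik.2‖ ^ 2 = ∑ j, g j ^ 2 * r j := by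
    have hi : ∀ i, ∑ k, ‖u i k‖ ^ 2 = ∑ j, g j ^ 2 * ‖U i j‖ ^ 2 := by
      intro i
      rw [hu, ← Matrix.mul_assoc, sum_norm_sq_mul_unitary hB]
      simp [hG, Matrix.mul_diagonal, mul_pow, mul_comm]
    rw [Fintype.sum_prod_type]
    simp only [← Finset.mul_sum, hi, hr]
    simp only [Finset.mul_sum]
    rw [Finset.sum_comm]
    refine Finset.sum_congr rfl fun j _ => Finset.sum_congr rfl fun k _ => by ring
  have h3 : ∑ ik : n × n, t * (l ik.2 * ‖u ik.1 ik.2‖ ^ 2) = t * ∑ j, g j ^ 2 * q j := by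
    have hk : ∀ k, ∑ i, ‖u i k‖ ^ 2 = ∑ j, g j ^ 2 * ‖B j k‖ ^ 2 := by
      intro k
      rw [hu, sum_norm_sq_unitary_mul hU]
      simp [hG, Matrix.diagonal_mul, mul_pow]
    rw [← Finset.mul_sum, Fintype.sum_prod_type_right]
    simp only [← Finset.mul_sum, hk, hq]
    simp only [Finset.mul_sum]
    rw [Finset.sum_comm]
    refine Finset.sum_congr rfl fun j _ => Finset.sum_congr rfl fun k _ => by ring
  rw [Finset.sum_sub_distrib, Finset.sum_sub_distrib, h1, h2, h3, Finset.mul_sum,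
    Finset.mul_sum, ← Finset.sum_sub_distrib, ← Finset.sum_sub_distrib]
  refine Finset.sum_congr rfl fun j _ => ?_
  rcases (hq0 j).eq_or_lt with h | h
  · simp [hg, ← h]
  · have : 0 < r j + t * q j := by have := hr0 j; positivity
    have h' : r j / q j + t = (r j + t * q j) / q j := by field_simp
    have hrj : r j = (r j + t * q j) - t * q j := by ring
    simp only [hg]
    rw [h']
    generalize r j + t * q j = s at this hrj
    rw [hrj]
    field_simp
    ring

/-- Entropic uncertainty relation in the eigenbasis picture: `l` are the eigenvalues of the
state, `B` relates its eigenbasis to the second measurement basis, `U` relates the two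
measurement bases. -/
theorem sum_mul_log_add_le_log {n : Type*} [Fintype n] [DecidableEq n] {U B : Matrix n n ℂ}
    (hU : U ∈ Matrix.unitaryGroup n ℂ) (hB : B ∈ Matrix.unitaryGroup n ℂ)
    (l p q : n → ℝ) (hl : ∀ k, 0 ≤ l k) (hl1 : ∑ k, l k = 1)
    (hp : ∀ i, p i = ∑ k, l k * ‖(U * B) i k‖ ^ 2)
    (hq : ∀ j, q j = ∑ k, l k * ‖B j k‖ ^ 2) :
    0 < ∑ i, ∑ j, p i * q j * ‖U i j‖ ^ 2 ∧
    ∑ i, p i * Real.log (p i) + ∑ j, q j * Real.log (q j) - ∑ k, l k * Real.log (l k) ≤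
      Real.log (∑ i, ∑ j, p i * q j * ‖U i j‖ ^ 2) := by
  have hp0 : ∀ j, 0 ≤ p j := fun j => hp j ▸ Finset.sum_nonneg fun k _ => by
    have := hl k; positivity
  have hq0 : ∀ j, 0 ≤ q j := fun j => hq j ▸ Finset.sum_nonneg fun k _ => by
    have := hl k; positivity
  set r : n → ℝ := fun j => ∑ i, p i * ‖U i j‖ ^ 2 with hr
  have hr0 : ∀ j, 0 ≤ r j := fun j => Finset.sum_nonneg fun k _ => by
    have := hp0 k; positivity
  have hw0 : ∀ i k, 0 ≤ l k * ‖(U * B) i k‖ ^ 2 := fun i k => by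
    have := hl k; positivity
  have hwp : ∀ i k, l k * ‖(U * B) i k‖ ^ 2 ≠ 0 → 0 < p i := fun i k h => by
    rw [hp]
    exact Finset.sum_pos' (fun k _ => hw0 i k) ⟨k, Finset.mem_univ k, (hw0 i k).lt_of_ne' h⟩
  have hwl : ∀ i k, l k * ‖(U * B) i k‖ ^ 2 ≠ 0 → 0 < l k := fun i k h =>
    (hl k).lt_of_ne' (left_ne_zero_of_mul h)
  have hUU : Uᴴ * U = 1 := Matrix.mem_unitaryGroup_iff'.1 hU
  have hqr : ∀ j, q j ≠ 0 → 0 < r j := by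
    intro j hj
    refine (hr0 j).lt_of_ne' fun hrj => hj ?_
    have hz := (Finset.sum_eq_zero_iff_of_nonneg fun i _ => by
      have := hp0 i; positivity).1 hrj
    rw [hq]
    refine Finset.sum_eq_zero fun k _ => ?_
    by_contra hne
    have hlk := left_ne_zero_of_mul hne
    apply right_ne_zero_of_mul hne
    have hBU : B j k = ∑ i, star (U i j) * (U * B) i k := by
      have : B = Uᴴ * (U * B) := by rw [← Matrix.mul_assoc, hUU, Matrix.one_mul]
      conv_lhs => rw [this]
      rw [Matrix.mul_apply]; rfl
    rw [hBU, Finset.sum_eq_zero, norm_zero, zero_pow two_ne_zero]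
    intro i _
    rcases mul_eq_zero.1 (hz i (Finset.mem_univ i)) with h | h
    · have : l k * ‖(U * B) i k‖ ^ 2 = 0 := by
        by_contra h'
        exact (hwp i k h').ne' h
      have := (mul_eq_zero.1 this).resolve_left hlk
      have := norm_eq_zero.1 (pow_eq_zero_iff two_ne_zero |>.1 this)
      simp [this]
    · have := norm_eq_zero.1 (pow_eq_zero_iff two_ne_zero |>.1 h)
      simp [this]
  have hone : ∀ {V : Matrix n n ℂ}, V ∈ Matrix.unitaryGroup n ℂ → ∀ k,
      ∑ i, ‖V i k‖ ^ 2 = 1 := by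
    intro V hV k
    have := sum_norm_sq_unitary_mul hV 1 k
    rw [Matrix.mul_one] at this
    rw [this, Finset.sum_eq_single k] <;> simp +contextual
  have hUB : U * B ∈ Matrix.unitaryGroup n ℂ := mul_mem hU hB
  have hq1 : ∑ j, q j = 1 := by
    simp only [hq]
    rw [Finset.sum_comm]
    simp only [← Finset.mul_sum, hone hB, mul_one, hl1]
  have hw1 : ∑ ik : n × n, l ik.2 * ‖(U * B) ik.1 ik.2‖ ^ 2 = 1 := by
    rw [Fintype.sum_prod_type_right]
    simp only [← Finset.mul_sum, hone hUB, mul_one, hl1]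
  have hmain := sum_mul_log_le_of_resolvent_le
    (fun ik : n × n => l ik.2 * ‖(U * B) ik.1 ik.2‖ ^ 2) (fun ik => p ik.1 / l ik.2)
    q (fun j => r j / q j)
    (fun ik => div_nonneg (hp0 _) (hl _)) (fun j => div_nonneg (hr0 _) (hq0 _))
    (fun ik h => div_pos (hwp _ _ h) (hwl _ _ h))
    (fun j h => div_pos (hqr j h) ((hq0 j).lt_of_ne' h)) (hw1.trans hq1.symm)
    (fun t ht => sum_resolvent_le hU hB l p q r hl hp0 hq (fun _ => rfl) ht)
  have hL : ∑ ik : n × n, l ik.2 * ‖(U * B) ik.1 ik.2‖ ^ 2 * Real.log (p ik.1 / l ik.2)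
      = ∑ i, p i * Real.log (p i) - ∑ k, l k * Real.log (l k) := by
    have : ∀ ik : n × n,
        l ik.2 * ‖(U * B) ik.1 ik.2‖ ^ 2 * Real.log (p ik.1 / l ik.2)
        = l ik.2 * ‖(U * B) ik.1 ik.2‖ ^ 2 * Real.log (p ik.1)
          - l ik.2 * ‖(U * B) ik.1 ik.2‖ ^ 2 * Real.log (l ik.2) := by
      intro ik
      by_cases h : l ik.2 * ‖(U * B) ik.1 ik.2‖ ^ 2 = 0
      · simp [h]
      · rw [Real.log_div (hwp _ _ h).ne' (hwl _ _ h).ne', mul_sub]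
    simp only [this]
    rw [Finset.sum_sub_distrib, Fintype.sum_prod_type, Fintype.sum_prod_type_right]
    simp only [← Finset.sum_mul, ← hp, ← Finset.mul_sum, hone hUB, mul_one]
  have hR : ∑ j, q j * Real.log (r j / q j)
      = ∑ j, q j * Real.log (r j) - ∑ j, q j * Real.log (q j) := by
    rw [← Finset.sum_sub_distrib]
    refine Finset.sum_congr rfl fun j _ => ?_
    by_cases h : q j = 0
    · simp [h]
    · rw [Real.log_div (hqr j h).ne' h, mul_sub]
  rw [hL, hR] at hmain
  have hS : ∑ i, ∑ j, p i * q j * ‖U i j‖ ^ 2 = ∑ j, q j * r j := by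
    rw [Finset.sum_comm]
    simp only [hr, Finset.mul_sum]
    exact Finset.sum_congr rfl fun j _ => Finset.sum_congr rfl fun i _ => by ring
  rw [hS]
  have hpos : 0 < ∑ j, q j * r j := by
    obtain ⟨j, -, hj⟩ := Finset.exists_ne_zero_of_sum_ne_zero (hq1.trans_ne one_ne_zero)
    exact Finset.sum_pos' (fun j _ => mul_nonneg (hq0 j) (hr0 j))
      ⟨j, Finset.mem_univ j, mul_pos ((hq0 j).lt_of_ne' hj) (hqr j hj)⟩
  refine ⟨hpos, ?_⟩
  set R := ∑ j, q j * r j with hRdef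
  have hJ : ∑ j, q j * Real.log (r j) ≤ Real.log R := by
    have : ∀ j ∈ Finset.univ,
        q j * Real.log (r j) ≤ q j * (Real.log R - 1) + q j * r j / R := by
      intro j _
      by_cases h : q j = 0
      · simp [h]
      · have h1 := Real.log_le_sub_one_of_pos (div_pos (hqr j h) hpos)
        rw [Real.log_div (hqr j h).ne' hpos.ne'] at h1
        rw [mul_div_assoc, ← mul_add]
        exact mul_le_mul_of_nonneg_left (by linarith) (hq0 j)
    refine (Finset.sum_le_sum this).trans (le_of_eq ?_)
    rw [Finset.sum_add_distrib, ← Finset.sum_mul, ← Finset.sum_div, hq1, ← hRdef,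
      div_self hpos.ne']
    ring
  linarith

/-- Abel summation: comparison of partial sums passes to sums weighted by an antitone
nonnegative vector. -/
theorem sum_mul_le_sum_mul_of_partial_sums_le {N : ℕ} (P Q c : Fin N → ℝ)
    (hc0 : ∀ k, 0 ≤ c k) (hc : Antitone c)
    (h : ∀ m : Fin N, ∑ k ∈ Finset.Iic m, P k ≤ ∑ k ∈ Finset.Iic m, Q k) :
    ∑ k, P k * c k ≤ ∑ k, Q k * c k := by
  induction N with
  | zero => simp
  | succ N ih =>
    have hlast : ∀ R : Fin (N + 1) → ℝ, ∑ k, R k * c k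
        = ∑ k : Fin N, R k.castSucc * (c k.castSucc - c (Fin.last N))
          + c (Fin.last N) * ∑ k, R k := by
      intro R
      rw [Fin.sum_univ_castSucc, Fin.sum_univ_castSucc (f := R)]
      simp only [mul_sub, Finset.sum_sub_distrib, ← Finset.sum_mul]
      ring
    rw [hlast, hlast]
    refine add_le_add (ih (fun k => P k.castSucc) (fun k => Q k.castSucc)
      (fun k => c k.castSucc - c (Fin.last N)) (fun k => sub_nonneg.2 (hc (Fin.le_last _)))
      (fun a b hab => sub_le_sub_right (hc (Fin.castSucc_le_castSucc_iff.2 hab)) _) ?_) ?_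
    · intro m
      have := h m.castSucc
      rwa [← Fin.map_castSuccEmb_Iic, Finset.sum_map, Finset.sum_map] at this
    · refine mul_le_mul_of_nonneg_left ?_ (hc0 _)
      have := h (Fin.last N)
      rwa [← Fin.top_eq_last, Finset.Iic_top] at this

/-- The initial segment maximizes sums of an antitone nonnegative vector among index sets of
at most its cardinality. -/
theorem sum_le_sum_Iic_of_antitone {N : ℕ} {Q : Fin N → ℝ} (hQ0 : ∀ k, 0 ≤ Q k)
    (hQ : Antitone Q) (m : Fin N) (B : Finset (Fin N))
    (hB : B.card ≤ (Finset.Iic m).card) :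
    ∑ k ∈ B, Q k ≤ ∑ k ∈ Finset.Iic m, Q k := by
  have hcard : (B \ Finset.Iic m).card ≤ (Finset.Iic m \ B).card := by
    have h1 := Finset.card_sdiff_add_card_inter B (Finset.Iic m)
    have h2 := Finset.card_sdiff_add_card_inter (Finset.Iic m) B
    rw [Finset.inter_comm] at h2
    omega
  rw [← Finset.sum_inter_add_sum_sdiff B (Finset.Iic m),
    ← Finset.sum_inter_add_sum_sdiff (Finset.Iic m) B, Finset.inter_comm]
  gcongr 1
  calc ∑ k ∈ B \ Finset.Iic m, Q k ≤ (B \ Finset.Iic m).card • Q m :=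
          Finset.sum_le_card_nsmul _ _ _ fun k hk => hQ (by
            simp only [Finset.mem_sdiff, Finset.mem_Iic, not_le] at hk; exact hk.2.le)
      _ ≤ (Finset.Iic m \ B).card • Q m := nsmul_le_nsmul_left (hQ0 m) hcard
      _ ≤ ∑ k ∈ Finset.Iic m \ B, Q k :=
          Finset.card_nsmul_le_sum _ _ _ fun k hk => hQ (by
            simp only [Finset.mem_sdiff, Finset.mem_Iic] at hk; exact hk.1)

/-- Pairing a majorized vector with an antitone nonnegative vector. -/
theorem Majorizes.sum_mul_le {ι : Type*} [Fintype ι] {N : ℕ} {P : ι → ℝ} {Q : Fin N → ℝ}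
    (hmaj : Majorizes P Q) (hQ0 : ∀ k, 0 ≤ Q k) (hQ : Antitone Q) (e : Fin N ≃ ι)
    {c : Fin N → ℝ} (hc0 : ∀ k, 0 ≤ c k) (hc : Antitone c) :
    ∑ k, P (e k) * c k ≤ ∑ k, Q k * c k := by
  refine sum_mul_le_sum_mul_of_partial_sums_le _ Q c hc0 hc fun m => ?_
  obtain ⟨B, hB, hle⟩ := hmaj.2 ((Finset.Iic m).map e.toEmbedding)
  rw [Finset.card_map] at hB
  rw [Finset.sum_map] at hle
  exact hle.trans (sum_le_sum_Iic_of_antitone hQ0 hQ m B hB)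

/-- Diagonal entries of a unitary conjugate of a real diagonal matrix. -/
theorem re_mul_diagonal_mul_conjTranspose_apply {n : Type*} [Fintype n] [DecidableEq n]
    (W : Matrix n n ℂ) (l : n → ℝ) (i : n) :
    ((W * Matrix.diagonal (fun k => (l k : ℂ)) * Wᴴ) i i).re = ∑ k, l k * ‖W i k‖ ^ 2 := by
  rw [Matrix.mul_apply, Complex.re_sum]
  refine Finset.sum_congr rfl fun k _ => ?_
  rw [Matrix.mul_diagonal, Matrix.conjTranspose_apply, mul_right_comm, RCLike.star_def,
    Complex.mul_conj', mul_comm]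
  norm_cast

/-- **B_RPZ1**: for any density matrix `ρ`, unitary `U`, induced probability vectors
`p`, `q`, sorted vector `c` of the values `|U i j|²`, and any decreasingly sorted
probability vector `Q` with `p ⊗ q ≺ Q`, one has
`H(p) + H(q) ≥ -ln (Q ⬝ c) + S(ρ)`. -/
theorem stmt_0 (d : ℕ) (hd : 2 ≤ d)
    (U : Matrix (Fin d) (Fin d) ℂ) (hU : U ∈ Matrix.unitaryGroup (Fin d) ℂ)
    (ρ : Matrix (Fin d) (Fin d) ℂ) (hρ : ρ.PosSemidef) (hρtr : ρ.trace = 1)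
    (p q : Fin d → ℝ)
    (hp : ∀ i, p i = (ρ i i).re)
    (hq : ∀ j, q j = ((Uᴴ * ρ * U) j j).re)
    -- `c` is the vector of the `d²` values `|U i j|²` sorted in decreasing order
    (c : Fin (d * d) → ℝ) (e : Fin (d * d) ≃ Fin d × Fin d)
    (hc : ∀ k, c k = ‖U (e k).1 (e k).2‖ ^ 2) (hcmono : Antitone c)
    -- `Q` is a probability vector sorted in decreasing order which majorizes `p ⊗ q`
    (Q : Fin (d * d) → ℝ) (hQ0 : ∀ k, 0 ≤ Q k) (hQ1 : ∑ k, Q k = 1)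
    (hQmono : Antitone Q)
    (hmaj : Majorizes (fun ij : Fin d × Fin d => p ij.1 * q ij.2) Q) :
    shannonEntropy p + shannonEntropy q ≥
      -Real.log (∑ k, Q k * c k) + vonNeumannEntropy hρ.isHermitian := by
  set E : Matrix (Fin d) (Fin d) ℂ := hρ.isHermitian.eigenvectorUnitary.1
  set l := hρ.isHermitian.eigenvalues with hl
  have hEmem : E ∈ Matrix.unitaryGroup (Fin d) ℂ := hρ.isHermitian.eigenvectorUnitary.2
  have hspec : ρ = E * Matrix.diagonal (fun k => (l k : ℂ)) * Eᴴ := by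
    have := hρ.isHermitian.spectral_theorem
    rw [Unitary.conjStarAlgAut_apply] at this
    exact this
  have hU' : Uᴴ ∈ Matrix.unitaryGroup (Fin d) ℂ := Unitary.star_mem hU
  have hUU : U * Uᴴ = 1 := Matrix.mem_unitaryGroup_iff.1 hU
  have hUB : U * (Uᴴ * E) = E := by rw [← Matrix.mul_assoc, hUU, Matrix.one_mul]
  have hl1 : ∑ k, l k = 1 := by
    have := hρ.isHermitian.trace_eq_sum_eigenvalues
    rw [hρtr] at this
    simpa [hl] using (congrArg Complex.re this).symm
  have hp' : ∀ i, p i = ∑ k, l k * ‖(U * (Uᴴ * E)) i k‖ ^ 2 := by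
    intro i
    rw [hUB, hp, ← re_mul_diagonal_mul_conjTranspose_apply, ← hspec]
  have hq' : ∀ j, q j = ∑ k, l k * ‖(Uᴴ * E) j k‖ ^ 2 := by
    intro j
    rw [hq, ← re_mul_diagonal_mul_conjTranspose_apply, Matrix.conjTranspose_mul,
      Matrix.conjTranspose_conjTranspose]
    conv_lhs => rw [hspec]
    simp only [Matrix.mul_assoc]
  obtain ⟨hpos, hmain⟩ := sum_mul_log_add_le_log hU (mul_mem hU' hEmem) l p q
    hρ.eigenvalues_nonneg hl1 hp' hq'
  have hS : ∑ k, p (e k).1 * q (e k).2 * c k = ∑ i, ∑ j, p i * q j * ‖U i j‖ ^ 2 := by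
    simp only [hc]
    rw [e.sum_comp (fun ij : Fin d × Fin d => p ij.1 * q ij.2 * ‖U ij.1 ij.2‖ ^ 2),
      Fintype.sum_prod_type]
  have hle := hmaj.sum_mul_le hQ0 hQmono e (fun k => by rw [hc]; positivity) hcmono
  rw [hS] at hle
  have hlog := Real.log_le_log hpos hle
  simp only [shannonEntropy, vonNeumannEntropy, ← hl]
  linarith
end

section
/- For any density matrix ρ and any d×d unitary matrix U relating two orthonormal bases, with induced probability vectors p and q, one has H(p) + H(q) ≥ −ln[c₁C² + c₂(1−C²)] + S(ρ), where c₁ and c₂ are the largest and second largest among the d² values |U_{ij}|², and C = (1+√c₁)/2. (This is the bound B_RPZ2.) -/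
open scoped BigOperators Matrix ComplexConjugate ComplexOrder

/-- Consequence of the three lines theorem at the boundary point `0`: an exponential sum with
`F 0 = 1` that is bounded by `1` on `re z = 0` and by `T` on `re z = 1` has logarithmic derivative
at most `log T` there. -/
lemma re_sum_mul_le_log_of_norm_expSum_le {ι : Type*} [Fintype ι] (w : ι → ℂ) (a : ι → ℝ) (T : ℝ)
    (hT : 0 < T) (hw : ∑ s, w s = 1)
    (h₀ : ∀ z : ℂ, z.re = 0 → ‖∑ s, w s * Complex.exp (z * a s)‖ ≤ 1)
    (h₁ : ∀ z : ℂ, z.re = 1 → ‖∑ s, w s * Complex.exp (z * a s)‖ ≤ T) :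
    (∑ s, w s * a s).re ≤ Real.log T := by
  set F : ℂ → ℂ := fun z => ∑ s, w s * Complex.exp (z * a s) with hF
  have hdiff : Differentiable ℂ F := by fun_prop
  have hB : BddAbove ((norm ∘ F) '' Complex.HadamardThreeLines.verticalClosedStrip 0 1) := by
    refine ⟨∑ s, ‖w s‖ * Real.exp |a s|, ?_⟩
    rintro _ ⟨z, hz, rfl⟩
    refine (norm_sum_le _ _).trans (Finset.sum_le_sum fun s _ => ?_)
    rw [norm_mul, Complex.norm_exp]
    gcongr
    simp only [Complex.HadamardThreeLines.verticalClosedStrip, Set.mem_preimage, Set.mem_Icc] at hz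
    rw [Complex.re_mul_ofReal]
    calc z.re * a s ≤ z.re * |a s| := by gcongr; exacts [hz.1, le_abs_self _]
      _ ≤ 1 * |a s| := by gcongr; exact hz.2
      _ = |a s| := one_mul _
  have hbound : ∀ x ∈ Set.Icc (0 : ℝ) 1, (F x).re ≤ T ^ x := by
    intro x hx
    have := Complex.HadamardThreeLines.norm_le_interp_of_mem_verticalClosedStrip₀₁' F (z := (x : ℂ))
      (a := 1) (b := T) (by simpa [Complex.HadamardThreeLines.verticalClosedStrip] using hx)
      hdiff.diffContOnCl hB (fun z hz => h₀ z (by simpa using hz))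
      (fun z hz => h₁ z (by simpa using hz))
    exact (Complex.re_le_norm _).trans (by simpa using this)
  have hF' : HasDerivAt F (∑ s, w s * a s) ((0 : ℝ) : ℂ) := by
    refine HasDerivAt.fun_sum fun s _ => ?_
    simpa using (((hasDerivAt_id ((0 : ℝ) : ℂ)).mul_const (a s : ℂ)).cexp).const_mul (w s)
  have hg : HasDerivAt (fun x : ℝ => (F x).re - T ^ x) ((∑ s, w s * a s).re - Real.log T) 0 := by
    refine hF'.real_of_complex.sub ?_
    simpa using (Real.hasStrictDerivAt_const_rpow hT 0).hasDerivAt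
  have hmax : IsLocalMaxOn (fun x : ℝ => (F x).re - T ^ x) (Set.Icc 0 1) 0 := by
    refine Filter.eventually_of_mem self_mem_nhdsWithin fun x hx => ?_
    have : F 0 = 1 := by simp [hF, hw]
    simpa [this] using hbound x hx
  have := hmax.hasFDerivWithinAt_nonpos hg.hasFDerivAt.hasFDerivWithinAt (y := 1)
    (mem_posTangentConeAt_of_segment_subset (by simp [segment_eq_Icc]))
  simpa using this

lemma sum_norm_sq_unitary_mulVec {n : Type*} [Fintype n] [DecidableEq n] {W : Matrix n n ℂ}
    (hW : W ∈ Matrix.unitaryGroup n ℂ) (x : n → ℂ) :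
    ∑ k, ‖(W *ᵥ x) k‖ ^ 2 = ∑ i, ‖x i‖ ^ 2 := by
  have key : ∀ v : n → ℂ, ((∑ i, ‖v i‖ ^ 2 : ℝ) : ℂ) = star v ⬝ᵥ v := by
    intro v
    simp [dotProduct, Complex.conj_mul']
  have hW' : Wᴴ * W = 1 := Matrix.mem_unitaryGroup_iff'.1 hW
  apply Complex.ofReal_injective
  rw [key, key, Matrix.star_mulVec, Matrix.dotProduct_mulVec, Matrix.vecMul_vecMul, hW',
    Matrix.vecMul_one]

section Overlap

variable {n : Type*} [Fintype n] [DecidableEq n] {U V : Matrix n n ℂ}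

lemma sum_norm_sq_weighted_overlap_left (hV : V ∈ Matrix.unitaryGroup n ℂ) (u : n → ℂ) (j : n) :
    ∑ k, ‖∑ i, star (V i k) * U i j * u i‖ ^ 2 = ∑ i, ‖u i‖ ^ 2 * ‖U i j‖ ^ 2 := by
  have hV' : Vᴴ ∈ Matrix.unitaryGroup n ℂ := Unitary.star_mem hV
  have := sum_norm_sq_unitary_mulVec hV' (fun i => U i j * u i)
  simpa [Matrix.mulVec, dotProduct, mul_assoc, mul_pow, mul_comm (‖U _ j‖ ^ 2)] using this

lemma sum_norm_sq_weighted_overlap_right (hU : U ∈ Matrix.unitaryGroup n ℂ) (u : n → ℂ) (k : n) :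
    ∑ j, ‖∑ i, star (V i k) * U i j * u i‖ ^ 2 = ∑ i, ‖u i‖ ^ 2 * ‖V i k‖ ^ 2 := by
  have hU' : Uᵀ ∈ Matrix.unitaryGroup n ℂ := by
    rw [Matrix.mem_unitaryGroup_iff', Matrix.star_eq_conjTranspose, Matrix.conjTranspose,
      Matrix.transpose_transpose]
    have h := congrArg Matrix.transpose (Matrix.mem_unitaryGroup_iff.1 hU)
    rw [Matrix.transpose_mul, Matrix.transpose_one] at h
    exact h
  have := sum_norm_sq_unitary_mulVec hU' (fun i => star (V i k) * u i)
  simpa [Matrix.mulVec, dotProduct, mul_left_comm, mul_comm, mul_assoc, mul_pow] using this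

lemma sum_norm_sq_col (hU : U ∈ Matrix.unitaryGroup n ℂ) (j : n) : ∑ i, ‖U i j‖ ^ 2 = 1 := by
  have := sum_norm_sq_unitary_mulVec hU (Pi.single j 1)
  simpa [Pi.single_apply, apply_ite] using this


/-- A finite-sum form of the Gibbs variational principle combined with the Golden–Thompson
inequality, for a density matrix with spectrum `μ` and eigenvector matrix `V` and two observables
with spectra `x`, `y`, diagonal in the standard basis and in the basis of columns of `U`. -/
lemma gibbs_le_log_sum_exp (hU : U ∈ Matrix.unitaryGroup n ℂ) (hV : V ∈ Matrix.unitaryGroup n ℂ)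
    (μ x y : n → ℝ) (hμ : ∀ k, 0 ≤ μ k) (hμ1 : ∑ k, μ k = 1) :
    -∑ k, μ k * Real.log (μ k) + ∑ i, (∑ k, μ k * ‖V i k‖ ^ 2) * x i
      + ∑ j, (∑ k, μ k * ‖∑ i, star (V i k) * U i j‖ ^ 2) * y j
      ≤ Real.log (∑ j, ∑ i, Real.exp (x i) * Real.exp (y j) * ‖U i j‖ ^ 2) := by
  set A : n → n → n → ℂ := fun k j i => star (V i k) * U i j with hA
  have hrow : ∀ (u : n → ℂ) (k : n),
      ∑ j, ‖∑ i, A k j i * u i‖ ^ 2 = ∑ i, ‖u i‖ ^ 2 * ‖V i k‖ ^ 2 :=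
    sum_norm_sq_weighted_overlap_right hU
  have hcol : ∀ (u : n → ℂ) (j : n),
      ∑ k, ‖∑ i, A k j i * u i‖ ^ 2 = ∑ i, ‖u i‖ ^ 2 * ‖U i j‖ ^ 2 :=
    sum_norm_sq_weighted_overlap_left hV
  have hAM : ∀ k j i, star (V i k) * U i j = A k j i := fun _ _ _ => rfl
  simp only [hAM]
  clear_value A
  let w : n × n × n × n → ℂ := fun s => μ s.1 * A s.1 s.2.1 s.2.2.1 * star (A s.1 s.2.1 s.2.2.2)
  let a : n × n × n × n → ℝ := fun s =>
    -Real.log (μ s.1) + y s.2.1 + x s.2.2.1 / 2 + x s.2.2.2 / 2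
  have hrow1 : ∀ k, ∑ j, ‖∑ i, A k j i‖ ^ 2 = 1 := by
    intro k
    have := hrow 1 k
    simpa [sum_norm_sq_col hV] using this
  have hT : 0 < ∑ j, ∑ i, Real.exp (x i) * Real.exp (y j) * ‖U i j‖ ^ 2 := by
    obtain ⟨k⟩ : Nonempty n := by
      by_contra h
      rw [not_nonempty_iff] at h
      simp at hμ1
    refine Finset.sum_pos' (fun j _ => by positivity) ⟨k, Finset.mem_univ _, ?_⟩
    have h1 := sum_norm_sq_col hU k
    obtain ⟨i, -, hi⟩ := Finset.exists_ne_zero_of_sum_ne_zero (h1.trans_ne one_ne_zero)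
    exact Finset.sum_pos' (fun i _ => by positivity) ⟨i, Finset.mem_univ _, by positivity⟩
  have hnorm : ∀ z : ℂ, ‖∑ s, w s * Complex.exp (z * a s)‖ ≤
      ∑ k, ∑ j, μ k * Real.exp (-(z.re * Real.log (μ k))) * Real.exp (z.re * y j) *
        ((‖∑ i, A k j i * Complex.exp (z * x i / 2)‖ ^ 2
          + ‖∑ i, A k j i * star (Complex.exp (z * x i / 2))‖ ^ 2) / 2) := by
    intro z
    have hfac : ∑ s, w s * Complex.exp (z * a s) =
        ∑ k, ∑ j, μ k * Complex.exp (-(z * Real.log (μ k))) * Complex.exp (z * y j) *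
          ((∑ i, A k j i * Complex.exp (z * x i / 2)) *
            star (∑ i, A k j i * star (Complex.exp (z * x i / 2)))) := by
      simp only [Fintype.sum_prod_type]
      refine Finset.sum_congr rfl fun k _ => Finset.sum_congr rfl fun j _ => ?_
      rw [star_sum, Finset.sum_mul_sum, Finset.mul_sum]
      refine Finset.sum_congr rfl fun i _ => ?_
      rw [Finset.mul_sum]
      refine Finset.sum_congr rfl fun l _ => ?_
      have : z * (a (k, j, i, l) : ℂ) = -(z * Real.log (μ k)) + z * y j + z * x i / 2
          + z * x l / 2 := by
        simp only [a]; push_cast; ring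
      rw [this, Complex.exp_add, Complex.exp_add, Complex.exp_add, star_mul', star_star]
      simp only [w]
      ring
    rw [hfac]
    refine (norm_sum_le _ _).trans (Finset.sum_le_sum fun k _ => (norm_sum_le _ _).trans
      (Finset.sum_le_sum fun j _ => ?_))
    rw [norm_mul, norm_mul, norm_mul, norm_mul, norm_star, Complex.norm_exp, Complex.norm_exp,
      Complex.norm_real, Real.norm_of_nonneg (hμ k), Complex.neg_re, Complex.re_mul_ofReal,
      Complex.re_mul_ofReal]
    have := hμ k
    gcongr
    linarith [two_mul_le_add_sq ‖∑ i, A k j i * Complex.exp (z * x i / 2)‖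
      ‖∑ i, A k j i * star (Complex.exp (z * x i / 2))‖]
  have hexp : ∀ (z : ℂ) (i : n), ‖Complex.exp (z * x i / 2)‖ ^ 2 = Real.exp (z.re * x i) := by
    intro z i
    rw [Complex.norm_exp, ← Real.exp_nat_mul]
    congr 1
    simp [mul_div_assoc]
    ring
  have hw : ∑ s, w s = 1 := by
    have : ∑ s, w s = ((∑ k, μ k * ∑ j, ‖∑ i, A k j i‖ ^ 2 : ℝ) : ℂ) := by
      push_cast
      simp only [Fintype.sum_prod_type, Finset.mul_sum]
      refine Finset.sum_congr rfl fun k _ => Finset.sum_congr rfl fun j _ => ?_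
      rw [← Complex.mul_conj', map_sum, Finset.sum_mul_sum, Finset.mul_sum]
      refine Finset.sum_congr rfl fun i _ => ?_
      rw [Finset.mul_sum]
      refine Finset.sum_congr rfl fun l _ => ?_
      simp only [w, mul_assoc]
      rfl
    rw [this]
    simp [hrow1, hμ1]
  have hmain := re_sum_mul_le_log_of_norm_expSum_le w a _ hT hw ?_ ?_
  · refine le_trans (le_of_eq ?_) hmain
    have hcross : ∀ k, ∑ j, ((∑ i, A k j i * x i) * star (∑ i, A k j i)).re
        = ∑ i, x i * ‖V i k‖ ^ 2 := by
      intro k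
      have h1 := hrow (fun i => x i + 1) k
      have h2 := hrow (fun i => x i - 1) k
      have e : ∀ j, ((∑ i, A k j i * x i) * star (∑ i, A k j i)).re
          = (‖∑ i, A k j i * (x i + 1)‖ ^ 2 - ‖∑ i, A k j i * (x i - 1)‖ ^ 2) / 4 := by
        intro j
        simp only [mul_add, mul_sub, mul_one, Finset.sum_add_distrib, Finset.sum_sub_distrib]
        simp only [← Complex.normSq_eq_norm_sq, Complex.normSq_add, Complex.normSq_sub]
        rw [Complex.star_def]
        ring
      rw [Finset.sum_congr rfl fun j _ => e j, ← Finset.sum_div, Finset.sum_sub_distrib, h1, h2,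
        ← Finset.sum_sub_distrib, Finset.sum_div]
      refine Finset.sum_congr rfl fun i _ => ?_
      have e1 : ‖(x i : ℂ) + 1‖ ^ 2 = (x i + 1) ^ 2 := by
        rw [← Complex.ofReal_one, ← Complex.ofReal_add, Complex.norm_real, Real.norm_eq_abs, sq_abs]
      have e2 : ‖(x i : ℂ) - 1‖ ^ 2 = (x i - 1) ^ 2 := by
        rw [← Complex.ofReal_one, ← Complex.ofReal_sub, Complex.norm_real, Real.norm_eq_abs, sq_abs]
      rw [e1, e2]
      ring
    have hsum : (∑ s, w s * a s).re = ∑ k, ∑ j, μ k * ((-Real.log (μ k) + y j)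
        * ‖∑ i, A k j i‖ ^ 2 + ((∑ i, A k j i * x i) * star (∑ i, A k j i)).re) := by
      simp only [Fintype.sum_prod_type, Complex.re_sum]
      refine Finset.sum_congr rfl fun k _ => Finset.sum_congr rfl fun j _ => ?_
      have e : ∑ i, ∑ l, w (k, j, i, l) * a (k, j, i, l) =
          μ k * ((-Real.log (μ k) + y j : ℝ) * ((∑ i, A k j i) * star (∑ i, A k j i))
            + ((∑ i, A k j i * x i) * star (∑ i, A k j i)) / 2
            + star ((∑ i, A k j i * x i) * star (∑ i, A k j i)) / 2) := by
        rw [star_mul', star_star, mul_comm (star _) (∑ i, A k j i), star_sum, star_sum,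
          Finset.sum_mul_sum, Finset.sum_mul_sum, Finset.sum_mul_sum]
        simp only [Finset.mul_sum, Finset.sum_div, ← Finset.sum_add_distrib]
        refine Finset.sum_congr rfl fun i _ => Finset.sum_congr rfl fun l _ => ?_
        simp only [w, a, star_mul', Complex.star_def, Complex.conj_ofReal]
        push_cast
        ring
      simp only [← Complex.re_sum]
      rw [e, Complex.re_ofReal_mul, Complex.add_re, Complex.add_re, Complex.re_ofReal_mul,
        Complex.star_def, Complex.mul_conj', Complex.div_ofNat_re,
        Complex.div_ofNat_re, Complex.conj_re, ← Complex.ofReal_pow, Complex.ofReal_re]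
      ring
    rw [hsum]
    have e3 : ∀ k, ∑ j, μ k * ((-Real.log (μ k) + y j)
        * ‖∑ i, A k j i‖ ^ 2 + ((∑ i, A k j i * x i) * star (∑ i, A k j i)).re)
        = -(μ k * Real.log (μ k)) + ∑ j, μ k * ‖∑ i, A k j i‖ ^ 2 * y j
          + ∑ i, μ k * ‖V i k‖ ^ 2 * x i := by
      intro k
      have : ∑ i, μ k * ‖V i k‖ ^ 2 * x i = μ k * ∑ i, x i * ‖V i k‖ ^ 2 := by
        rw [Finset.mul_sum]
        exact Finset.sum_congr rfl fun i _ => by ring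
      have h4 : -(μ k * Real.log (μ k)) = ∑ j, -(μ k * Real.log (μ k)) * ‖∑ i, A k j i‖ ^ 2 := by
        rw [← Finset.mul_sum, hrow1, mul_one]
      rw [this, ← hcross, h4, Finset.mul_sum, ← Finset.sum_add_distrib, ← Finset.sum_add_distrib]
      exact Finset.sum_congr rfl fun j _ => by ring
    rw [Finset.sum_congr rfl fun k _ => e3 k, Finset.sum_add_distrib, Finset.sum_add_distrib,
      Finset.sum_neg_distrib]
    simp only [Finset.sum_mul]
    rw [Finset.sum_comm (f := fun i k => μ k * ‖V i k‖ ^ 2 * x i),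
      Finset.sum_comm (f := fun j k => μ k * ‖∑ i, A k j i‖ ^ 2 * y j)]
    rw [add_right_comm]
  · intro z hz
    refine (hnorm z).trans (le_of_eq ?_)
    rw [← hμ1]
    refine Finset.sum_congr rfl fun k _ => ?_
    simp only [hz, zero_mul, neg_zero, Real.exp_zero, mul_one]
    rw [← Finset.mul_sum, ← Finset.sum_div, Finset.sum_add_distrib, hrow, hrow]
    simp only [norm_star, hexp, hz, zero_mul, Real.exp_zero, one_mul, sum_norm_sq_col hV]
    ring
  · intro z hz
    refine (hnorm z).trans ?_
    rw [Finset.sum_comm]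
    refine Finset.sum_le_sum fun j _ => ?_
    have hle : ∀ k, μ k * Real.exp (-(z.re * Real.log (μ k))) ≤ 1 := by
      intro k
      rcases (hμ k).eq_or_lt with h | h
      · simp [← h]
      · rw [hz, one_mul, Real.exp_neg, Real.exp_log h, mul_inv_cancel₀ h.ne']
    calc _ ≤ ∑ k, 1 * Real.exp (z.re * y j) *
        ((‖∑ i, A k j i * Complex.exp (z * x i / 2)‖ ^ 2
          + ‖∑ i, A k j i * star (Complex.exp (z * x i / 2))‖ ^ 2) / 2) := by
          gcongr with k; exact hle k
      _ = _ := by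
        rw [← Finset.mul_sum, ← Finset.sum_div, Finset.sum_add_distrib, hcol, hcol]
        simp only [norm_star, hexp, hz, one_mul, add_self_div_two, Finset.mul_sum]
        exact Finset.sum_congr rfl fun i _ => by ring

/-- The state-dependent bound `H(p) + H(q) - S(ρ) ≥ -log ∑ pᵢ qⱼ |Uᵢⱼ|²`, together with the
positivity that makes the logarithm meaningful, in exponential form. -/
lemma exp_entropy_gap_le (hU : U ∈ Matrix.unitaryGroup n ℂ) (hV : V ∈ Matrix.unitaryGroup n ℂ)
    (μ p q : n → ℝ) (hμ : ∀ k, 0 ≤ μ k) (hμ1 : ∑ k, μ k = 1)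
    (hp : ∀ i, p i = ∑ k, μ k * ‖V i k‖ ^ 2)
    (hq : ∀ j, q j = ∑ k, μ k * ‖∑ i, star (V i k) * U i j‖ ^ 2) :
    Real.exp (-∑ k, μ k * Real.log (μ k) - shannonEntropy p - shannonEntropy q)
      ≤ ∑ j, ∑ i, p i * q j * ‖U i j‖ ^ 2 := by
  have hp0 : ∀ i, 0 ≤ p i := fun i => by
    rw [hp]; exact Finset.sum_nonneg fun k _ => mul_nonneg (hμ k) (by positivity)
  have hq0 : ∀ i, 0 ≤ q i := fun i => by
    rw [hq]; exact Finset.sum_nonneg fun k _ => mul_nonneg (hμ k) (by positivity)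
  let r : (n → ℝ) → ℝ → n → ℝ := fun f ε i => if f i = 0 then ε else f i
  have hr : ∀ f : n → ℝ, (∀ i, 0 ≤ f i) → ∀ ε > 0, ∀ i, 0 < r f ε i := by
    intro f hf ε hε i
    simp only [r]
    split_ifs with h
    · exact hε
    · exact (hf i).lt_of_ne' h
  have hr0 : ∀ (f : n → ℝ) i, r f 0 i = f i := by
    intro f i
    simp only [r]
    split_ifs with h
    · exact h.symm
    · rfl
  have hH : ∀ (f : n → ℝ) ε, ∑ i, f i * Real.log (r f ε i) = -shannonEntropy f := by
    intro f ε
    rw [shannonEntropy, neg_neg]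
    refine Finset.sum_congr rfl fun i _ => ?_
    simp only [r]
    split_ifs with h
    · simp [h]
    · rfl
  have hcont : Continuous fun ε : ℝ => ∑ j, ∑ i, r p ε i * r q ε j * ‖U i j‖ ^ 2 := by
    have : ∀ (f : n → ℝ) i, Continuous fun ε => r f ε i := by
      intro f i
      simp only [r]
      split_ifs <;> fun_prop
    fun_prop
  have hlim := (hcont.tendsto 0).mono_left (nhdsWithin_le_nhds (s := Set.Ioi 0))
  simp only [hr0] at hlim
  refine ge_of_tendsto hlim (eventually_mem_nhdsWithin.mono fun ε (hε : 0 < ε) => ?_)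
  have key := gibbs_le_log_sum_exp hU hV μ (fun i => Real.log (r p ε i))
    (fun j => Real.log (r q ε j)) hμ hμ1
  simp only [← hp, ← hq, hH, Real.exp_log (hr p hp0 ε hε _), Real.exp_log (hr q hq0 ε hε _)] at key
  have hpos : 0 < ∑ j, ∑ i, r p ε i * r q ε j * ‖U i j‖ ^ 2 := by
    have hnn : ∀ j i, 0 ≤ r p ε i * r q ε j * ‖U i j‖ ^ 2 := fun j i =>
      mul_nonneg (mul_pos (hr p hp0 ε hε _) (hr q hq0 ε hε _)).le (by positivity)
    obtain ⟨k⟩ : Nonempty n := by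
      by_contra h
      rw [not_nonempty_iff] at h
      simp at hμ1
    refine Finset.sum_pos' (fun j _ => Finset.sum_nonneg fun i _ => hnn j i)
      ⟨k, Finset.mem_univ _, ?_⟩
    obtain ⟨i, -, hi⟩ := Finset.exists_ne_zero_of_sum_ne_zero
      ((sum_norm_sq_col hU k).trans_ne one_ne_zero)
    exact Finset.sum_pos' (fun i _ => hnn k i) ⟨i, Finset.mem_univ _,
      mul_pos (mul_pos (hr p hp0 ε hε _) (hr q hq0 ε hε _)) (by positivity)⟩
  rw [← Real.le_log_iff_exp_le hpos]
  linarith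

end Overlap

/-- Two unit vectors cannot both overlap strongly with a third one
(the norm of the sum of two rank-one projections is `1 + ‖⟪a, b⟫‖`). -/
lemma norm_inner_sq_add_norm_inner_sq_le {E : Type*} [NormedAddCommGroup E]
    [InnerProductSpace ℂ E] (a b v : E) (ha : ‖a‖ = 1) (hb : ‖b‖ = 1) (hv : ‖v‖ = 1) :
    ‖inner ℂ a v‖ ^ 2 + ‖inner ℂ b v‖ ^ 2 ≤ 1 + ‖inner ℂ a b‖ := by
  set α := inner ℂ a v with hα
  set β := inner ℂ b v with hβ
  set γ := ‖inner ℂ a b‖ with hγ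
  set s := ‖α‖ ^ 2 + ‖β‖ ^ 2 with hs
  have hγ0 : 0 ≤ γ := norm_nonneg _
  have h1 : s ≤ ‖α • a + β • b‖ := by
    have e : inner ℂ (α • a + β • b) v = (s : ℂ) := by
      rw [inner_add_left, inner_smul_left, inner_smul_left, ← hα, ← hβ, Complex.conj_mul',
        Complex.conj_mul', hs]
      push_cast
      ring
    have h := norm_inner_le_norm (𝕜 := ℂ) (α • a + β • b) v
    rw [e, hv, mul_one, Complex.norm_real] at h
    exact (le_abs_self s).trans h
  have h2 : ‖α • a + β • b‖ ^ 2 ≤ s * (1 + γ) := by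
    have e : RCLike.re (inner ℂ (α • a) (β • b)) ≤ ‖α‖ * ‖β‖ * γ := by
      refine (RCLike.re_le_norm _).trans (le_of_eq ?_)
      rw [inner_smul_left, inner_smul_right, norm_mul, norm_mul, RCLike.norm_conj]
      ring
    rw [norm_add_sq (𝕜 := ℂ), norm_smul, norm_smul, ha, hb]
    nlinarith [mul_le_mul_of_nonneg_right (two_mul_le_add_sq ‖α‖ ‖β‖) hγ0]
  have hs0 : 0 ≤ s := by positivity
  rcases hs0.eq_or_lt with h | h
  · rw [← h]; positivity
  · have : s * s ≤ s * (1 + γ) := by nlinarith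
    exact le_of_mul_le_mul_left this h

lemma norm_sq_add_norm_sq_overlap_le {n : Type*} [Fintype n] [DecidableEq n] {U V : Matrix n n ℂ}
    (hU : U ∈ Matrix.unitaryGroup n ℂ) (hV : V ∈ Matrix.unitaryGroup n ℂ) (i j k : n) :
    ‖V i k‖ ^ 2 + ‖∑ l, star (V l k) * U l j‖ ^ 2 ≤ 1 + ‖U i j‖ := by
  have hcol : ∀ {W : Matrix n n ℂ}, W ∈ Matrix.unitaryGroup n ℂ → ∀ j,
      ‖(WithLp.toLp 2 (fun l => W l j) : EuclideanSpace ℂ n)‖ = 1 := by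
    intro W hW j
    rw [EuclideanSpace.norm_eq]
    simp [sum_norm_sq_col hW]
  have h := norm_inner_sq_add_norm_inner_sq_le (EuclideanSpace.single i (1 : ℂ))
    (WithLp.toLp 2 fun l => U l j) (WithLp.toLp 2 fun l => V l k)
    (by simp) (hcol hU j) (hcol hV k)
  rw [norm_inner_symm (WithLp.toLp 2 (fun l => U l j) : EuclideanSpace ℂ n)] at h
  simpa [EuclideanSpace.inner_single_left, PiLp.inner_apply, mul_comm] using h

lemma re_conjTranspose_mul_mul_apply_self {n : Type*} [Fintype n] [DecidableEq n]
    {ρ : Matrix n n ℂ} (hρ : ρ.IsHermitian) (U : Matrix n n ℂ) (j : n) :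
    ((Uᴴ * ρ * U) j j).re = ∑ k, hρ.eigenvalues k *
      ‖∑ i, star ((hρ.eigenvectorUnitary : Matrix n n ℂ) i k) * U i j‖ ^ 2 := by
  set V : Matrix n n ℂ := hρ.eigenvectorUnitary.1
  have hs : ρ = V * Matrix.diagonal (fun k => (hρ.eigenvalues k : ℂ)) * Vᴴ := by
    conv_lhs => rw [hρ.spectral_theorem, Unitary.conjStarAlgAut_apply]
    rfl
  have h : Uᴴ * ρ * U
      = (Vᴴ * U)ᴴ * Matrix.diagonal (fun k => (hρ.eigenvalues k : ℂ)) * (Vᴴ * U) := by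
    conv_lhs => rw [hs]
    simp only [Matrix.conjTranspose_mul, Matrix.conjTranspose_conjTranspose, Matrix.mul_assoc]
  rw [h, Matrix.mul_apply, Complex.re_sum]
  refine Finset.sum_congr rfl fun k _ => ?_
  have e : ∑ i, star (V i k) * U i j = (Vᴴ * U) k j := by
    simp [Matrix.mul_apply, Matrix.conjTranspose_apply]
  rw [e, Matrix.mul_diagonal, Matrix.conjTranspose_apply, mul_right_comm, Complex.star_def,
    Complex.conj_mul', mul_comm, Complex.re_ofReal_mul, ← Complex.ofReal_pow, Complex.ofReal_re]

/-- **B_RPZ2**: `H(p) + H(q) ≥ -ln[c₁C² + c₂(1 - C²)] + S(ρ)`, where `c₁` and `c₂` are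
the largest and second largest among the `d²` values `|U i j|²` (obtained here as the
first two entries of the decreasingly sorted vector `c` of these values) and
`C = (1 + √c₁)/2`. -/
theorem stmt_1 (d : ℕ) (hd : 2 ≤ d)
    (U : Matrix (Fin d) (Fin d) ℂ) (hU : U ∈ Matrix.unitaryGroup (Fin d) ℂ)
    (ρ : Matrix (Fin d) (Fin d) ℂ) (hρ : ρ.PosSemidef) (hρtr : ρ.trace = 1)
    (p q : Fin d → ℝ)
    (hp : ∀ i, p i = (ρ i i).re)
    (hq : ∀ j, q j = ((Uᴴ * ρ * U) j j).re)
    -- `c` is the vector of the `d²` values `|U i j|²` sorted in decreasing order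
    (c : Fin (d * d) → ℝ) (e : Fin (d * d) ≃ Fin d × Fin d)
    (hc : ∀ k, c k = ‖U (e k).1 (e k).2‖ ^ 2) (hcmono : Antitone c)
    (c1 c2 : ℝ)
    (hc1 : c1 = c ⟨0, by nlinarith⟩)
    (hc2 : c2 = c ⟨1, by nlinarith⟩)
    (C : ℝ) (hC : C = (1 + Real.sqrt c1) / 2) :
    shannonEntropy p + shannonEntropy q ≥
      -Real.log (c1 * C ^ 2 + c2 * (1 - C ^ 2)) + vonNeumannEntropy hρ.isHermitian := by
  have hρh := hρ.isHermitian
  set μ : Fin d → ℝ := hρh.eigenvalues with hμdef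
  set V : Matrix (Fin d) (Fin d) ℂ := hρh.eigenvectorUnitary.1 with hVdef
  have hV : V ∈ Matrix.unitaryGroup (Fin d) ℂ := hρh.eigenvectorUnitary.2
  have hμ : ∀ k, 0 ≤ μ k := hρ.eigenvalues_nonneg
  have hμ1 : ∑ k, μ k = 1 := by
    have h := hρh.trace_eq_sum_eigenvalues
    rw [hρtr] at h
    refine Complex.ofReal_injective ?_
    rw [Complex.ofReal_sum, Complex.ofReal_one]
    exact h.symm
  have hp' : ∀ i, p i = ∑ k, μ k * ‖V i k‖ ^ 2 := by
    intro i
    have h := re_conjTranspose_mul_mul_apply_self hρh 1 i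
    simp only [Matrix.conjTranspose_one, one_mul, mul_one, ← hp, Matrix.one_apply, mul_ite,
      mul_zero, Finset.sum_ite_eq', Finset.mem_univ, if_true, norm_star] at h
    exact h
  have hq' : ∀ j, q j = ∑ k, μ k * ‖∑ i, star (V i k) * U i j‖ ^ 2 := fun j => by
    rw [hq, re_conjTranspose_mul_mul_apply_self hρh]
  have hp0 : ∀ i, 0 ≤ p i := fun i => by
    rw [hp']; exact Finset.sum_nonneg fun k _ => mul_nonneg (hμ k) (by positivity)
  have hq0 : ∀ i, 0 ≤ q i := fun i => by
    rw [hq']; exact Finset.sum_nonneg fun k _ => mul_nonneg (hμ k) (by positivity)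
  have hp1 : ∑ i, p i = 1 := by
    simp only [hp']
    rw [Finset.sum_comm]
    simp only [← Finset.mul_sum, sum_norm_sq_col hV, mul_one, hμ1]
  have hq1 : ∑ j, q j = 1 := by
    simp only [hq']
    rw [Finset.sum_comm]
    have h := fun k => sum_norm_sq_weighted_overlap_right (V := V) hU 1 k
    simp only [Pi.one_apply, mul_one, norm_one, one_pow, one_mul, sum_norm_sq_col hV] at h
    simp only [← Finset.mul_sum, h, mul_one, hμ1]
  have hgap := exp_entropy_gap_le hU hV μ p q hμ hμ1 hp' hq'
  set i₀ := (e ⟨0, by nlinarith⟩).1 with hi₀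
  set j₀ := (e ⟨0, by nlinarith⟩).2 with hj₀
  have hc1' : c1 = ‖U i₀ j₀‖ ^ 2 := by rw [hc1, hc]
  have hc21 : c2 ≤ c1 := by
    rw [hc1, hc2]
    exact hcmono (Fin.mk_le_mk.2 zero_le_one)
  have hle : ∀ i j, (i, j) ≠ (i₀, j₀) → ‖U i j‖ ^ 2 ≤ c2 := by
    intro i j hij
    have h := hc (e.symm (i, j))
    rw [Equiv.apply_symm_apply] at h
    rw [← h, hc2]
    refine hcmono (Fin.mk_le_mk.2 (Nat.one_le_iff_ne_zero.2 fun h0 => hij ?_))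
    have h0' : e.symm (i, j) = ⟨0, by nlinarith⟩ := Fin.ext h0
    rw [Equiv.symm_apply_eq] at h0'
    exact h0'
  have hC0 : Real.sqrt c1 = ‖U i₀ j₀‖ := by rw [hc1', Real.sqrt_sq (norm_nonneg _)]
  have hpq : p i₀ + q j₀ ≤ 2 * C := by
    rw [hC, hC0, hp', hq', ← Finset.sum_add_distrib]
    calc _ ≤ ∑ k, μ k * (1 + ‖U i₀ j₀‖) := by
          refine Finset.sum_le_sum fun k _ => ?_
          rw [← mul_add]
          exact mul_le_mul_of_nonneg_left (norm_sq_add_norm_sq_overlap_le hU hV i₀ j₀ k) (hμ k)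
      _ = _ := by rw [← Finset.sum_mul, hμ1]; ring
  have hprod : p i₀ * q j₀ ≤ C ^ 2 := by
    nlinarith [sq_nonneg (p i₀ - q j₀), hp0 i₀, hq0 j₀]
  have hsum : ∑ j, ∑ i, p i * q j * ‖U i j‖ ^ 2 ≤ c1 * C ^ 2 + c2 * (1 - C ^ 2) := by
    calc ∑ j, ∑ i, p i * q j * ‖U i j‖ ^ 2
        ≤ ∑ j, ∑ i, (p i * q j * c2
            + if j = j₀ then if i = i₀ then p i * q j * (c1 - c2) else 0 else 0) := by
          refine Finset.sum_le_sum fun j _ => Finset.sum_le_sum fun i _ => ?_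
          have hpos := mul_nonneg (hp0 i) (hq0 j)
          by_cases hj : j = j₀
          · by_cases hi : i = i₀
            · rw [if_pos hj, if_pos hi, hi, hj, hc1']
              linarith
            · rw [if_pos hj, if_neg hi, add_zero]
              exact mul_le_mul_of_nonneg_left (hle i j fun h => hi (congrArg Prod.fst h)) hpos
          · rw [if_neg hj, add_zero]
            exact mul_le_mul_of_nonneg_left (hle i j fun h => hj (congrArg Prod.snd h)) hpos
      _ = c2 + p i₀ * q j₀ * (c1 - c2) := by
          simp only [Finset.sum_add_distrib, ← Finset.sum_mul, hp1, one_mul, hq1]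
          simp
      _ ≤ _ := by nlinarith
  have hlog := (Real.le_log_iff_exp_le ((Real.exp_pos _).trans_le (hgap.trans hsum))).2
    (hgap.trans hsum)
  have hS : vonNeumannEntropy hρh = -∑ k, μ k * Real.log (μ k) := rfl
  rw [hS]
  linarith
end

section
/- For any density matrix ρ, any d×d unitary matrix U relating two orthonormal bases, the induced probability vectors p and q, and any probability vector Q ∈ ℝ^{d²} sorted in decreasing order such that p⊗q ≺ Q, the following holds. For each pair (k,l) ∈ {1,…,d}² let h_{kl} ∈ ℝ^{d²} be the vector of the values |U_{kj}|²|U_{il}|² over all pairs (i,j), sorted in decreasing order, and set f_{kl} = −ln(Q·h_{kl}) ≥ 0; let f^↑ ∈ ℝ^{d²} be the vector of the d² values f_{kl} sorted in increasing order. Then H(p) + H(q) ≥ (1/2) Q·f^↑ + S(ρ). (This is the bound B_RPZ3.) -/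
open scoped BigOperators Matrix ComplexConjugate ComplexOrder

/-- Abel summation: a vector with nonnegative initial sums pairs with a decreasing vector to at
least its total times the least entry of the latter. -/
theorem last_mul_sum_le_sum_mul_of_antitone (n : ℕ) (D g : Fin (n + 1) → ℝ) (hg : Antitone g)
    (hD : ∀ k : ℕ, 0 ≤ ∑ i : Fin (n + 1), if (i : ℕ) < k then D i else 0) :
    g (Fin.last n) * ∑ i, D i ≤ ∑ i, D i * g i := by
  induction n with
  | zero => simp [mul_comm]
  | succ n ih =>
    have h1 : ∀ k : ℕ, 0 ≤ ∑ i : Fin (n + 1), if (i : ℕ) < k then D i.castSucc else 0 := by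
      intro k
      have h2 := hD (min k (n + 1))
      rw [Fin.sum_univ_castSucc] at h2
      simp only [Fin.val_castSucc, Fin.val_last, lt_min_iff, lt_self_iff_false, and_false,
        if_false, add_zero] at h2
      convert h2 using 3 with i
      simp [i.isLt]
    have h3 := ih (fun i => D i.castSucc) (fun i => g i.castSucc)
      (fun a b hab => hg (Fin.castSucc_le_castSucc_iff.2 hab)) h1
    have h4 : 0 ≤ ∑ i : Fin (n + 1), D i.castSucc := by
      have h5 := h1 (n + 1)
      simpa only [Fin.is_lt, if_true] using h5
    have h6 : g (Fin.last (n + 1)) ≤ g (Fin.last n).castSucc := hg (Fin.le_last _)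
    rw [Fin.sum_univ_castSucc, Fin.sum_univ_castSucc (fun i => D i * g i)]
    nlinarith [mul_le_mul_of_nonneg_right h6 h4]

/-- A sum of at most `k` entries of a decreasing nonnegative vector is at most the sum of its
first `k` entries. -/
theorem sum_le_initial_sum_of_antitone {n : ℕ} (Q : Fin n → ℝ) (hQ0 : ∀ i, 0 ≤ Q i)
    (hQ : Antitone Q) (k : ℕ) (B : Finset (Fin n)) (hB : B.card ≤ k) :
    ∑ i ∈ B, Q i ≤ ∑ i : Fin n, if (i : ℕ) < k then Q i else 0 := by
  rcases le_or_gt n k with hk | hk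
  · have h1 : (∑ i : Fin n, if (i : ℕ) < k then Q i else 0) = ∑ i, Q i :=
      Finset.sum_congr rfl fun i _ => if_pos (i.isLt.trans_le hk)
    rw [h1]
    exact Finset.sum_le_sum_of_subset_of_nonneg (Finset.subset_univ _) fun i _ _ => hQ0 i
  · set c := Q ⟨k, hk⟩ with hc
    have h1 : ∑ i ∈ B, (Q i - c) ≤ ∑ i : Fin n, if (i : ℕ) < k then Q i - c else 0 := by
      rw [← Finset.sum_filter_add_sum_filter_not B (fun i : Fin n => (i : ℕ) < k),
        ← Finset.sum_filter]
      have h2 : ∑ i ∈ B.filter (fun i : Fin n => ¬ (i : ℕ) < k), (Q i - c) ≤ 0 := by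
        refine Finset.sum_nonpos fun i hi => ?_
        have : (⟨k, hk⟩ : Fin n) ≤ i := not_lt.1 (Finset.mem_filter.1 hi).2
        linarith [hQ this]
      have h3 : ∑ i ∈ B.filter (fun i : Fin n => (i : ℕ) < k), (Q i - c) ≤
          ∑ i ∈ Finset.univ.filter (fun i : Fin n => (i : ℕ) < k), (Q i - c) := by
        refine Finset.sum_le_sum_of_subset_of_nonneg
          (Finset.filter_subset_filter _ (Finset.subset_univ _)) fun i hi _ => ?_
        have : i ≤ (⟨k, hk⟩ : Fin n) := (Finset.mem_filter.1 hi).2.le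
        linarith [hQ this]
      linarith
    rw [← Finset.sum_filter] at h1 ⊢
    have h4 : (Finset.univ.filter fun i : Fin n => (i : ℕ) < k).card = k := by
      rw [Fin.card_filter_val_lt]
      exact min_eq_right hk.le
    rw [Finset.sum_sub_distrib, Finset.sum_sub_distrib, Finset.sum_const, Finset.sum_const, h4,
      nsmul_eq_mul, nsmul_eq_mul] at h1
    have h5 : (B.card : ℝ) * c ≤ k * c :=
      mul_le_mul_of_nonneg_right (by exact_mod_cast hB) (hQ0 _)
    linarith

/-- Pairing with a decreasing vector is monotone under majorization by a decreasing vector. -/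
theorem Majorizes.sum_mul_le_of_antitone {ι : Type*} [Fintype ι] {n : ℕ} {x : ι → ℝ}
    {Q : Fin n → ℝ} (hmaj : Majorizes x Q) (hQ0 : ∀ i, 0 ≤ Q i) (hQ : Antitone Q)
    (e : Fin n ≃ ι) {g : Fin n → ℝ} (hg : Antitone g) :
    ∑ m, x (e m) * g m ≤ ∑ m, Q m * g m := by
  classical
  cases n with
  | zero => simp
  | succ n =>
    have h1 := last_mul_sum_le_sum_mul_of_antitone n (fun m => Q m - x (e m)) g hg (by
      intro k
      obtain ⟨B, hBc, hB⟩ := hmaj.2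
        ((Finset.univ.filter fun i : Fin (n + 1) => (i : ℕ) < k).map e.toEmbedding)
      rw [Finset.card_map, Fin.card_filter_val_lt] at hBc
      rw [Finset.sum_map] at hB
      have h2 := sum_le_initial_sum_of_antitone Q hQ0 hQ k B (hBc.trans (min_le_right _ _))
      simp only [Equiv.coe_toEmbedding] at hB
      rw [← Finset.sum_filter] at h2 ⊢
      rw [Finset.sum_sub_distrib]
      linarith)
    have h3 : ∑ m, (Q m - x (e m)) = 0 := by
      rw [Finset.sum_sub_distrib, Equiv.sum_comp e x, hmaj.1, sub_self]
    simp only [h3, mul_zero, sub_mul, Finset.sum_sub_distrib] at h1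
    linarith

open Matrix in
theorem Matrix.mul_conjTranspose_self_apply_eq_sum_norm_sq {m n : Type*} [Fintype n]
    (N : Matrix m n ℂ) (b : m) :
    (N * Nᴴ) b b = ((∑ a, ‖N b a‖ ^ 2 : ℝ) : ℂ) := by
  simp [Matrix.mul_apply, Complex.mul_conj']

section Unitary

variable {n : Type*} [Fintype n] [DecidableEq n]

open Matrix

theorem Matrix.sum_norm_sq_row_mul_unitary {W : Matrix n n ℂ} (hW : W * Wᴴ = 1)
    (N : Matrix n n ℂ) (b : n) : ∑ a, ‖(N * W) b a‖ ^ 2 = ∑ l, ‖N b l‖ ^ 2 := by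
  have h1 : (N * W) * (N * W)ᴴ = N * Nᴴ := by
    rw [conjTranspose_mul, Matrix.mul_assoc, ← Matrix.mul_assoc W, hW, Matrix.one_mul]
  have h2 := congrFun (congrFun h1 b) b
  rw [mul_conjTranspose_self_apply_eq_sum_norm_sq,
    mul_conjTranspose_self_apply_eq_sum_norm_sq] at h2
  exact_mod_cast h2

theorem Matrix.sum_norm_sq_col_unitary_mul {U : Matrix n n ℂ} (hU : Uᴴ * U = 1)
    (N : Matrix n n ℂ) (a : n) : ∑ b, ‖(U * N) b a‖ ^ 2 = ∑ l, ‖N l a‖ ^ 2 := by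
  have h1 := sum_norm_sq_row_mul_unitary (W := Uᴴ) (by rwa [conjTranspose_conjTranspose]) Nᴴ a
  rw [← conjTranspose_mul] at h1
  simpa only [conjTranspose_apply, norm_star] using h1

/-- The scalar inequality behind the variational formula for a positive diagonal quadratic form. -/
theorem two_mul_re_sub_le_div (v M : ℂ) {r m : ℝ} (hm : 0 ≤ m) (hrm : m = 0 → r = 0) :
    2 * (r * (star M * v).re) - m * ‖M‖ ^ 2 ≤ ‖v‖ ^ 2 * r ^ 2 / m := by
  rcases hm.eq_or_lt with h0 | h0
  · simp [← h0, hrm h0.symm]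
  · rw [le_div_iff₀ h0, Complex.sq_norm, Complex.sq_norm, Complex.normSq_apply,
      Complex.normSq_apply]
    simp only [Complex.star_def, Complex.mul_re, Complex.conj_re, Complex.conj_im]
    nlinarith [sq_nonneg (r * v.re - m * M.re), sq_nonneg (r * v.im - m * M.im)]

/-- Monotonicity under a projective measurement of the quadratic functional
`⟨√ρ, (α Δ + β)⁻¹ √ρ⟩`, `Δ` being the relative modular operator. -/
theorem sum_sq_div_measured_le {U W : Matrix n n ℂ} (hU : Uᴴ * U = 1) (hW : W * Wᴴ = 1)
    {p r : n → ℝ} (hp : ∀ i, 0 ≤ p i) (hr : ∀ i, 0 ≤ r i) {α β : ℝ} (hα : 0 ≤ α) (hβ : 0 < β) :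
    ∑ l, (∑ a, ‖W l a‖ ^ 2 * r a) ^ 2 /
        (α * (∑ b, ‖U b l‖ ^ 2 * p b) + β * (∑ a, ‖W l a‖ ^ 2 * r a)) ≤
      ∑ b, ∑ a, ‖(U * W) b a‖ ^ 2 * r a ^ 2 / (α * p b + β * r a) := by
  set q : n → ℝ := fun l => ∑ a, ‖W l a‖ ^ 2 * r a with hq
  set s : n → ℝ := fun l => ∑ b, ‖U b l‖ ^ 2 * p b with hs
  have hq0 : ∀ l, 0 ≤ q l := fun l => Finset.sum_nonneg fun a _ => mul_nonneg (sq_nonneg _) (hr a)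
  have hs0 : ∀ l, 0 ≤ s l := fun l => Finset.sum_nonneg fun a _ => mul_nonneg (sq_nonneg _) (hp a)
  set y : n → ℝ := fun l => q l / (α * s l + β * q l) with hy
  set Y : Matrix n n ℂ := diagonal fun l => (y l : ℂ) with hY
  set M : Matrix n n ℂ := U * Y * W with hM
  have hterm : ∀ l, q l ^ 2 / (α * s l + β * q l) =
      2 * (y l * q l) - (α * (y l ^ 2 * s l) + β * (y l ^ 2 * q l)) := by
    intro l
    have h1 : 0 ≤ α * s l := mul_nonneg hα (hs0 l)
    have h2 : 0 ≤ β * q l := mul_nonneg hβ.le (hq0 l)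
    rcases (add_nonneg h1 h2).eq_or_lt with h0 | h0
    · have h3 : q l = 0 := by
        have : β * q l = 0 := by linarith
        exact (mul_eq_zero.1 this).resolve_left hβ.ne'
      simp [hy, h3]
    · have h4 : y l * (α * s l + β * q l) = q l := div_mul_cancel₀ _ h0.ne'
      rw [sq, mul_div_right_comm]
      change y l * q l = _
      linear_combination (y l) * h4
  have hrow : ∑ b, ∑ a, ‖M b a‖ ^ 2 * p b = ∑ l, y l ^ 2 * s l := by
    simp_rw [← Finset.sum_mul, hM, sum_norm_sq_row_mul_unitary hW, hY, mul_diagonal, norm_mul,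
      Complex.norm_real, mul_pow, Real.norm_eq_abs, sq_abs, hs, Finset.sum_mul, Finset.mul_sum]
    rw [Finset.sum_comm]
    exact Finset.sum_congr rfl fun l _ => Finset.sum_congr rfl fun b _ => by ring
  have hcol : ∑ b, ∑ a, ‖M b a‖ ^ 2 * r a = ∑ l, y l ^ 2 * q l := by
    rw [Finset.sum_comm]
    simp_rw [← Finset.sum_mul, hM, Matrix.mul_assoc, sum_norm_sq_col_unitary_mul hU, hY,
      diagonal_mul, norm_mul, Complex.norm_real, mul_pow, Real.norm_eq_abs, sq_abs, hq,
      Finset.sum_mul, Finset.mul_sum]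
    rw [Finset.sum_comm]
    exact Finset.sum_congr rfl fun l _ => Finset.sum_congr rfl fun b _ => by ring
  have hcross : ∑ b, ∑ a, r a * (star (M b a) * (U * W) b a).re = ∑ l, y l * q l := by
    have h1 : Mᴴ * (U * W) = Wᴴ * (Y * W) := by
      have hYs : Yᴴ = Y := by
        rw [hY, diagonal_conjTranspose]
        congr 1
        ext l
        simp
      rw [hM, conjTranspose_mul, conjTranspose_mul, hYs, Matrix.mul_assoc, Matrix.mul_assoc,
        ← Matrix.mul_assoc Uᴴ, hU, Matrix.one_mul]
    have h2 : ∀ a, ∑ b, (star (M b a) * (U * W) b a).re = ∑ l, y l * ‖W l a‖ ^ 2 := by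
      intro a
      have h3 := congrArg Complex.re (congrFun (congrFun h1 a) a)
      rw [Matrix.mul_apply, Matrix.mul_apply, Complex.re_sum, Complex.re_sum] at h3
      simp only [conjTranspose_apply] at h3
      rw [h3]
      refine Finset.sum_congr rfl fun l _ => ?_
      rw [hY, diagonal_mul, Complex.sq_norm, Complex.normSq_apply]
      simp
      ring
    rw [Finset.sum_comm]
    simp_rw [← Finset.mul_sum, h2, hq, Finset.mul_sum]
    rw [Finset.sum_comm]
    exact Finset.sum_congr rfl fun l _ => Finset.sum_congr rfl fun b _ => by ring
  calc ∑ l, q l ^ 2 / (α * s l + β * q l)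
      = 2 * (∑ l, y l * q l) - (α * (∑ l, y l ^ 2 * s l) + β * (∑ l, y l ^ 2 * q l)) := by
        simp_rw [hterm, Finset.sum_sub_distrib, Finset.sum_add_distrib, Finset.mul_sum]
    _ = ∑ b, ∑ a, (2 * (r a * (star (M b a) * (U * W) b a).re)
          - (α * p b + β * r a) * ‖M b a‖ ^ 2) := by
        rw [← hrow, ← hcol, ← hcross]
        simp_rw [Finset.mul_sum, ← Finset.sum_add_distrib, ← Finset.sum_sub_distrib]
        exact Finset.sum_congr rfl fun l _ => Finset.sum_congr rfl fun b _ => by ring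
    _ ≤ _ := by
        refine Finset.sum_le_sum fun b _ => Finset.sum_le_sum fun a _ => ?_
        have h1 : 0 ≤ α * p b := mul_nonneg hα (hp b)
        have h2 : 0 ≤ β * r a := mul_nonneg hβ.le (hr a)
        refine two_mul_re_sub_le_div _ _ (add_nonneg h1 h2) fun h0 => ?_
        have : β * r a = 0 := by linarith
        exact (mul_eq_zero.1 this).resolve_left hβ.ne'

theorem hasDerivAt_mul_log_segment {c s r : ℝ} (h : c = 0 ∨ 0 < s ∧ 0 < r) {t : ℝ}
    (ht : t ∈ Set.Icc (0 : ℝ) 1) :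
    HasDerivAt (fun t => c * Real.log ((1 - t) * s + t * r))
      (c * (r - s) / ((1 - t) * s + t * r)) t := by
  rcases h with rfl | ⟨hs, hr⟩
  · simpa using hasDerivAt_const t (0 : ℝ)
  · have h0 : 0 < (1 - t) * s + t * r := by
      rcases ht.1.eq_or_lt with rfl | h1
      · simpa using hs
      · exact add_pos_of_nonneg_of_pos (mul_nonneg (sub_nonneg.2 ht.2) hs.le) (mul_pos h1 hr)
    have h1 : HasDerivAt (fun t : ℝ => (1 - t) * s + t * r) (r - s) t := by
      have := (((hasDerivAt_id t).const_sub 1).mul_const s).add ((hasDerivAt_id t).mul_const r)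
      refine (this.congr_deriv (by ring)).congr_of_eventuallyEq (.of_forall fun x => ?_)
      simp
    rw [mul_div_assoc]
    exact (h1.log h0.ne').const_mul c

/-- Monotonicity of the relative entropy under a projective measurement:
`p` and `r` are the spectra of the two states, `U * W` relates their
eigenbases, and the measurement is in the basis given by the columns of `U`. -/
theorem measured_relative_entropy_le {U W : Matrix n n ℂ} (hU : Uᴴ * U = 1) (hW : W * Wᴴ = 1)
    {p r : n → ℝ} (hp : ∀ i, 0 ≤ p i) (hr : ∀ i, 0 ≤ r i)
    (hsupp : ∀ b a, 0 < ‖(U * W) b a‖ ^ 2 * r a → 0 < p b)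
    (hsupp' : ∀ l, 0 < ∑ a, ‖W l a‖ ^ 2 * r a → 0 < ∑ b, ‖U b l‖ ^ 2 * p b) :
    ∑ l, (∑ a, ‖W l a‖ ^ 2 * r a) * (Real.log (∑ a, ‖W l a‖ ^ 2 * r a)
        - Real.log (∑ b, ‖U b l‖ ^ 2 * p b)) ≤
      ∑ b, ∑ a, ‖(U * W) b a‖ ^ 2 * r a * (Real.log (r a) - Real.log (p b)) := by
  have hcol : ∀ a, ∑ b, ‖(U * W) b a‖ ^ 2 = ∑ l, ‖W l a‖ ^ 2 :=
    fun a => sum_norm_sq_col_unitary_mul hU W a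
  have hle : ∀ t : ℝ, 0 ≤ 1 - t → 0 < t → _ := fun t h0 h1 =>
    sum_sq_div_measured_le hU hW hp hr h0 h1
  set q : n → ℝ := fun l => ∑ a, ‖W l a‖ ^ 2 * r a with hq
  set s : n → ℝ := fun l => ∑ b, ‖U b l‖ ^ 2 * p b with hs
  set C : n → n → ℝ := fun b a => ‖(U * W) b a‖ ^ 2 * r a with hC
  have hq0 : ∀ l, 0 ≤ q l := fun l => Finset.sum_nonneg fun a _ => mul_nonneg (sq_nonneg _) (hr a)
  have hC0 : ∀ b a, 0 ≤ C b a := fun b a => mul_nonneg (sq_nonneg _) (hr a)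
  have hCp : ∀ b a, C b a = 0 ∨ 0 < p b ∧ 0 < r a := by
    intro b a
    rcases (hC0 b a).eq_or_lt with h | h
    · exact Or.inl h.symm
    · exact Or.inr ⟨hsupp b a h, pos_of_mul_pos_right h (sq_nonneg _)⟩
  have hqs : ∀ l, q l = 0 ∨ 0 < s l ∧ 0 < q l := by
    intro l
    rcases (hq0 l).eq_or_lt with h | h
    · exact Or.inl h.symm
    · exact Or.inr ⟨hsupp' l h, h⟩
  have htot : ∑ b, ∑ a, C b a = ∑ l, q l := by
    rw [Finset.sum_comm, Finset.sum_comm (f := fun l a => ‖W l a‖ ^ 2 * r a)]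
    simp_rw [hC, ← Finset.sum_mul, hcol]
  set F : ℝ → ℝ := fun t => ∑ b, ∑ a, C b a * Real.log ((1 - t) * p b + t * r a)
    - ∑ l, q l * Real.log ((1 - t) * s l + t * q l) with hF
  set F' : ℝ → ℝ := fun t => ∑ b, ∑ a, C b a * (r a - p b) / ((1 - t) * p b + t * r a)
    - ∑ l, q l * (q l - s l) / ((1 - t) * s l + t * q l) with hF'
  have hder : ∀ t ∈ Set.Icc (0 : ℝ) 1, HasDerivAt F (F' t) t := by
    intro t ht
    exact (HasDerivAt.fun_sum fun b _ => HasDerivAt.fun_sum fun a _ =>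
      hasDerivAt_mul_log_segment (hCp b a) ht).sub
      (HasDerivAt.fun_sum fun l _ => hasDerivAt_mul_log_segment (hqs l) ht)
  have hF'0 : ∀ t ∈ Set.Ioo (0 : ℝ) 1, 0 ≤ F' t := by
    intro t ht
    have ht1 : 0 < 1 - t := sub_pos.2 ht.2
    have key : ∀ c s r : ℝ, (c = 0 ∨ 0 < s ∧ 0 < r) →
        (1 - t) * (c * (r - s) / ((1 - t) * s + t * r)) =
          c * r / ((1 - t) * s + t * r) - c := by
      rintro c s r (rfl | ⟨hs, hr⟩)
      · simp
      · have : 0 < (1 - t) * s + t * r := add_pos (mul_pos ht1 hs) (mul_pos ht.1 hr)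
        field_simp
        ring
    have h1 : (1 - t) * F' t = ∑ b, ∑ a, C b a * r a / ((1 - t) * p b + t * r a)
        - ∑ l, q l * q l / ((1 - t) * s l + t * q l) := by
      rw [hF']
      simp_rw [mul_sub (1 - t), Finset.mul_sum, key _ _ _ (hCp _ _), key _ _ _ (hqs _),
        Finset.sum_sub_distrib, htot]
      ring
    have h2 := hle t ht1.le ht.1
    have h3 : 0 ≤ (1 - t) * F' t := by
      rw [h1, sub_nonneg]
      convert h2 using 4
      · ring
      · simp only [hC]
        ring
    exact nonneg_of_mul_nonneg_right h3 ht1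
  have hmono : MonotoneOn F (Set.Icc 0 1) := by
    refine monotoneOn_of_hasDerivWithinAt_nonneg (f' := F') (convex_Icc 0 1)
      (fun t ht => (hder t ht).continuousAt.continuousWithinAt)
      (fun t ht => (hder t (interior_subset ht)).hasDerivWithinAt) ?_
    intro t ht
    rw [interior_Icc] at ht
    exact hF'0 t ht
  have h01 := hmono (Set.left_mem_Icc.2 zero_le_one) (Set.right_mem_Icc.2 zero_le_one) zero_le_one
  simp only [hF, sub_zero, one_mul, zero_mul, add_zero, sub_self, zero_add] at h01
  simp_rw [mul_sub, Finset.sum_sub_distrib]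
  linarith

end Unitary

/-- The entropic uncertainty relation with the averaged overlap term: `r` is the spectrum of a
state with eigenbasis `U * W` in the first measurement basis and `W` in the second one. -/
theorem entropic_uncertainty_overlap {n : Type*} [Fintype n] [DecidableEq n]
    {U W : Matrix n n ℂ} (hU : Uᴴ * U = 1) (hW : W * Wᴴ = 1) {p q r : n → ℝ}
    (hr : ∀ i, 0 ≤ r i) (hp : ∀ b, p b = ∑ a, ‖(U * W) b a‖ ^ 2 * r a)
    (hq : ∀ l, q l = ∑ a, ‖W l a‖ ^ 2 * r a) :
    (∀ l, 0 < q l → 0 < ∑ b, ‖U b l‖ ^ 2 * p b) ∧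
    -∑ i, r i * Real.log (r i) - ∑ l, q l * Real.log (∑ b, ‖U b l‖ ^ 2 * p b) ≤
      shannonEntropy p + shannonEntropy q := by
  have hp0 : ∀ b, 0 ≤ p b := fun b => by
    rw [hp]
    exact Finset.sum_nonneg fun a _ => mul_nonneg (sq_nonneg _) (hr a)
  have hterm : ∀ b a, ‖(U * W) b a‖ ^ 2 * r a ≤ p b := fun b a => by
    rw [hp]
    exact Finset.single_le_sum (f := fun a => ‖(U * W) b a‖ ^ 2 * r a)
      (fun a _ => mul_nonneg (sq_nonneg _) (hr a)) (Finset.mem_univ a)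
  have hsupp : ∀ l, 0 < q l → 0 < ∑ b, ‖U b l‖ ^ 2 * p b := by
    intro l hl
    have hs0 : ∀ b ∈ Finset.univ, 0 ≤ ‖U b l‖ ^ 2 * p b :=
      fun b _ => mul_nonneg (sq_nonneg _) (hp0 b)
    refine (Finset.sum_nonneg hs0).lt_of_ne' fun h0 => hl.ne' ?_
    rw [Finset.sum_eq_zero_iff_of_nonneg hs0] at h0
    rw [hq]
    refine Finset.sum_eq_zero fun a _ => ?_
    rcases (hr a).eq_or_lt with h1 | h1
    · simp [← h1]
    · have h2 : W l a = ∑ b, star (U b l) * (U * W) b a := by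
        have h3 : W = Uᴴ * (U * W) := by rw [← Matrix.mul_assoc, hU, Matrix.one_mul]
        have h4 := congrFun (congrFun h3 l) a
        rw [Matrix.mul_apply] at h4
        exact h4
      have h5 : W l a = 0 := by
        rw [h2]
        refine Finset.sum_eq_zero fun b hb => ?_
        rcases mul_eq_zero.1 (h0 b hb) with h6 | h6
        · have : U b l = 0 := by simpa using h6
          simp [this]
        · have h7 := hterm b a
          rw [h6] at h7
          have h8 : ‖(U * W) b a‖ ^ 2 = 0 :=
            le_antisymm (nonpos_of_mul_nonpos_left h7 h1) (sq_nonneg _)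
          have : (U * W) b a = 0 := by simpa using h8
          simp [this]
      simp [h5]
  refine ⟨hsupp, ?_⟩
  have h1 := measured_relative_entropy_le hU hW hp0 hr
    (fun b a h => h.trans_le (hterm b a)) (fun l h => hsupp l (by rwa [hq]))
  simp_rw [← hq, mul_sub, Finset.sum_sub_distrib] at h1
  have h2 : ∑ b, ∑ a, ‖(U * W) b a‖ ^ 2 * r a * Real.log (p b) = ∑ b, p b * Real.log (p b) := by
    simp_rw [← Finset.sum_mul, ← hp]
  have hcol : ∀ a, ∑ b, ‖(U * W) b a‖ ^ 2 = 1 := by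
    intro a
    have h3 : (U * W)ᴴ * ((U * W)ᴴ)ᴴ = 1 := by
      rw [Matrix.conjTranspose_conjTranspose, Matrix.conjTranspose_mul, Matrix.mul_assoc,
        ← Matrix.mul_assoc Uᴴ, hU, Matrix.one_mul, mul_eq_one_comm]
      exact hW
    have h4 := Matrix.mul_conjTranspose_self_apply_eq_sum_norm_sq (U * W)ᴴ a
    rw [h3, Matrix.one_apply_eq] at h4
    simp only [Matrix.conjTranspose_apply, norm_star] at h4
    exact_mod_cast h4.symm
  have h3 : ∑ b, ∑ a, ‖(U * W) b a‖ ^ 2 * r a * Real.log (r a) = ∑ a, r a * Real.log (r a) := by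
    rw [Finset.sum_comm]
    simp_rw [← Finset.sum_mul, hcol, one_mul]
  rw [h2, h3] at h1
  unfold shannonEntropy
  linarith

theorem re_diag_conj_diagonal {n : Type*} [Fintype n] [DecidableEq n] (V : Matrix n n ℂ)
    (r : n → ℝ) (b : n) :
    ((V * Matrix.diagonal (fun i => (r i : ℂ)) * Vᴴ) b b).re = ∑ a, ‖V b a‖ ^ 2 * r a := by
  rw [Matrix.mul_apply, Complex.re_sum]
  refine Finset.sum_congr rfl fun a _ => ?_
  rw [Matrix.mul_diagonal, Matrix.conjTranspose_apply, Complex.sq_norm, Complex.normSq_apply]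
  simp
  ring

/-- **B_RPZ3**: with `Q` a decreasingly sorted probability vector majorizing `p ⊗ q`,
`h kl` the decreasingly sorted vector of the values `|U k j|² |U i l|²` over pairs
`(i, j)`, `f kl = -ln (Q ⬝ h kl) ≥ 0`, and `fup` the increasingly sorted rearrangement
of `f`, one has `H(p) + H(q) ≥ (1/2) Q ⬝ fup + S(ρ)`. -/
theorem stmt_2 (d : ℕ) (hd : 2 ≤ d)
    (U : Matrix (Fin d) (Fin d) ℂ) (hU : U ∈ Matrix.unitaryGroup (Fin d) ℂ)
    (ρ : Matrix (Fin d) (Fin d) ℂ) (hρ : ρ.PosSemidef) (hρtr : ρ.trace = 1)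
    (p q : Fin d → ℝ)
    (hp : ∀ i, p i = (ρ i i).re)
    (hq : ∀ j, q j = ((Uᴴ * ρ * U) j j).re)
    -- `Q` is a probability vector sorted in decreasing order which majorizes `p ⊗ q`
    (Q : Fin (d * d) → ℝ) (hQ0 : ∀ k, 0 ≤ Q k) (hQ1 : ∑ k, Q k = 1)
    (hQmono : Antitone Q)
    (hmaj : Majorizes (fun ij : Fin d × Fin d => p ij.1 * q ij.2) Q)
    -- for each `(k, l)`, `h (k, l)` is the vector of the values `|U k j|² |U i l|²`
    -- over pairs `(i, j)`, sorted in decreasing order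
    (h : Fin d × Fin d → Fin (d * d) → ℝ)
    (eh : Fin d × Fin d → Fin (d * d) ≃ Fin d × Fin d)
    (hh : ∀ kl m, h kl m = ‖U kl.1 (eh kl m).2‖ ^ 2 * ‖U (eh kl m).1 kl.2‖ ^ 2)
    (hhmono : ∀ kl, Antitone (h kl))
    -- `f kl = -ln (Q ⬝ h kl)`
    (f : Fin d × Fin d → ℝ)
    (hf : ∀ kl, f kl = -Real.log (∑ m, Q m * h kl m))
    -- `fup` is the vector of the `d²` values `f kl`, sorted in increasing order
    (fup : Fin (d * d) → ℝ) (ef : Fin (d * d) ≃ Fin d × Fin d)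
    (hfup : ∀ m, fup m = f (ef m)) (hfupmono : Monotone fup) :
    (∀ kl, 0 ≤ f kl) ∧
      shannonEntropy p + shannonEntropy q ≥
        (1 / 2) * (∑ m, Q m * fup m) + vonNeumannEntropy hρ.isHermitian := by
  obtain ⟨V, hV1, hV2, hVρ⟩ : ∃ V : Matrix (Fin d) (Fin d) ℂ, Vᴴ * V = 1 ∧ V * Vᴴ = 1 ∧
      ρ = V * Matrix.diagonal (fun i => (hρ.isHermitian.eigenvalues i : ℂ)) * Vᴴ := by
    refine ⟨hρ.isHermitian.eigenvectorUnitary, ?_, ?_, ?_⟩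
    · exact Unitary.coe_star_mul_self hρ.isHermitian.eigenvectorUnitary
    · exact Unitary.coe_mul_star_self hρ.isHermitian.eigenvectorUnitary
    · exact hρ.isHermitian.spectral_theorem
  set r := hρ.isHermitian.eigenvalues with hr
  have hr0 : ∀ i, 0 ≤ r i := hρ.eigenvalues_nonneg
  have hU1 : Uᴴ * U = 1 := (Matrix.mem_unitaryGroup_iff').1 hU
  have hU2 : U * Uᴴ = 1 := (Matrix.mem_unitaryGroup_iff).1 hU
  set W := Uᴴ * V with hWdef
  have hUW : U * W = V := by rw [hWdef, ← Matrix.mul_assoc, hU2, Matrix.one_mul]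
  have hW : W * Wᴴ = 1 := by
    rw [hWdef, Matrix.conjTranspose_mul, Matrix.conjTranspose_conjTranspose, Matrix.mul_assoc,
      ← Matrix.mul_assoc V, hV2, Matrix.one_mul, hU1]
  have hp' : ∀ b, p b = ∑ a, ‖V b a‖ ^ 2 * r a := fun b => by
    rw [hp, ← re_diag_conj_diagonal, ← hVρ]
  have hq' : ∀ l, q l = ∑ a, ‖W l a‖ ^ 2 * r a := fun l => by
    rw [hq, ← re_diag_conj_diagonal, hVρ, hWdef, Matrix.conjTranspose_mul,
      Matrix.conjTranspose_conjTranspose]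
    simp only [Matrix.mul_assoc]
  have hp0 : ∀ b, 0 ≤ p b := fun b => by
    rw [hp']
    exact Finset.sum_nonneg fun a _ => mul_nonneg (sq_nonneg _) (hr0 a)
  have hq0 : ∀ b, 0 ≤ q b := fun b => by
    rw [hq']
    exact Finset.sum_nonneg fun a _ => mul_nonneg (sq_nonneg _) (hr0 a)
  have hp1 : ∑ i, p i = 1 := by
    simp_rw [hp, ← Complex.re_sum]
    change (ρ.trace).re = 1
    rw [hρtr, Complex.one_re]
  have hq1 : ∑ i, q i = 1 := by
    simp_rw [hq, ← Complex.re_sum]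
    change ((Uᴴ * ρ * U).trace).re = 1
    rw [Matrix.trace_mul_comm, ← Matrix.mul_assoc, hU2, Matrix.one_mul, hρtr, Complex.one_re]
  have hUle : ∀ i j, ‖U i j‖ ^ 2 ≤ 1 := fun i j =>
    pow_le_one₀ (norm_nonneg _) (entry_norm_bound_of_unitary hU i j)
  have hh0 : ∀ kl m, 0 ≤ h kl m := fun kl m => by
    rw [hh]
    positivity
  have hh1 : ∀ kl m, h kl m ≤ 1 := fun kl m => by
    rw [hh]
    exact mul_le_one₀ (hUle _ _) (sq_nonneg _) (hUle _ _)
  refine ⟨fun kl => ?_, ?_⟩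
  · rw [hf, neg_nonneg]
    refine Real.log_nonpos (Finset.sum_nonneg fun m _ => mul_nonneg (hQ0 m) (hh0 kl m)) ?_
    rw [← hQ1]
    exact Finset.sum_le_sum fun m _ => mul_le_of_le_one_right (hQ0 m) (hh1 kl m)
  obtain ⟨hs, hS⟩ := entropic_uncertainty_overlap (p := p) (q := q) hU1 hW hr0
    (by rwa [hUW]) hq'
  obtain ⟨ht, hT⟩ := entropic_uncertainty_overlap (U := Uᴴ) (W := V) (p := q) (q := p)
    (by rwa [Matrix.conjTranspose_conjTranspose]) hV2 hr0 hq' hp'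
  simp only [Matrix.conjTranspose_apply, norm_star] at ht hT
  set s : Fin d → ℝ := fun l => ∑ b, ‖U b l‖ ^ 2 * p b with hsdef
  set t : Fin d → ℝ := fun k => ∑ j, ‖U k j‖ ^ 2 * q j with htdef
  have hst : ∀ kl : Fin d × Fin d, t kl.1 * s kl.2 ≤ ∑ m, Q m * h kl m := by
    intro kl
    refine le_trans (le_of_eq ?_) (hmaj.sum_mul_le_of_antitone hQ0 hQmono (eh kl) (hhmono kl))
    simp_rw [hh]
    rw [Equiv.sum_comp (eh kl) (fun ij : Fin d × Fin d =>
      p ij.1 * q ij.2 * (‖U kl.1 ij.2‖ ^ 2 * ‖U ij.1 kl.2‖ ^ 2)), Fintype.sum_prod_type,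
      mul_comm, hsdef, htdef, Finset.sum_mul_sum]
    exact Finset.sum_congr rfl fun i _ => Finset.sum_congr rfl fun j _ => by ring
  have hpt : ∀ kl : Fin d × Fin d, p kl.1 * q kl.2 * f kl ≤
      p kl.1 * q kl.2 * -(Real.log (t kl.1) + Real.log (s kl.2)) := by
    intro kl
    rcases (hp0 kl.1).eq_or_lt with h1 | h1
    · simp [← h1]
    rcases (hq0 kl.2).eq_or_lt with h2 | h2
    · simp [← h2]
    refine mul_le_mul_of_nonneg_left ?_ (mul_pos h1 h2).le
    have h3 : 0 < t kl.1 := ht _ h1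
    have h4 : 0 < s kl.2 := hs _ h2
    rw [hf, ← Real.log_mul h3.ne' h4.ne']
    exact neg_le_neg (Real.log_le_log (mul_pos h3 h4) (hst kl))
  have hsum : ∑ kl : Fin d × Fin d, p kl.1 * q kl.2 * f kl ≤
      -(∑ k, p k * Real.log (t k)) - ∑ l, q l * Real.log (s l) := by
    refine (Finset.sum_le_sum fun kl _ => hpt kl).trans (le_of_eq ?_)
    rw [Fintype.sum_prod_type]
    have h1 : ∀ k l, p k * q l * -(Real.log (t k) + Real.log (s l)) =
        -(p k * Real.log (t k) * q l) - p k * (q l * Real.log (s l)) := fun k l => by ring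
    simp_rw [h1, Finset.sum_sub_distrib, Finset.sum_neg_distrib, ← Finset.mul_sum,
      ← Finset.sum_mul, hq1, hp1, one_mul, mul_one]
  have hfQ : ∑ m, Q m * fup m ≤ ∑ kl : Fin d × Fin d, p kl.1 * q kl.2 * f kl := by
    have h1 := hmaj.sum_mul_le_of_antitone hQ0 hQmono ef (g := fun m => -fup m)
      (fun a b hab => neg_le_neg (hfupmono hab))
    simp_rw [mul_neg, Finset.sum_neg_distrib, hfup] at h1
    rw [Equiv.sum_comp ef (fun kl : Fin d × Fin d => p kl.1 * q kl.2 * f kl)] at h1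
    simp_rw [hfup]
    linarith
  have hvN : vonNeumannEntropy hρ.isHermitian = -∑ i, r i * Real.log (r i) := rfl
  rw [hvN]
  linarith
end

section
/- For any density matrix ρ and any d×d unitary matrix U relating two orthonormal bases, with induced probability vectors p and q, one has the mixed-state Maassen–Uffink-type bound H(p) + H(q) ≥ −ln c₁ + S(ρ), where c₁ = max_{i,j} |U_{ij}|². -/
open scoped BigOperators Matrix ComplexConjugate ComplexOrder

theorem re_sum_mul_le_log_of_norm_le {ι : Type*} (s : Finset ι) (c : ι → ℂ) (t : ι → ℝ)
    {K : ℝ} (hK : 0 < K) (h_zero : ∑ i ∈ s, c i = 1)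
    (h_left : ∀ z : ℂ, z.re = 0 → ‖∑ i ∈ s, c i * Complex.exp (z * t i)‖ ≤ 1)
    (h_right : ∀ z : ℂ, z.re = 1 → ‖∑ i ∈ s, c i * Complex.exp (z * t i)‖ ≤ K) :
    (∑ i ∈ s, c i * t i).re ≤ Real.log K := by
  set F : ℂ → ℂ := fun z => ∑ i ∈ s, c i * Complex.exp (z * t i) with hF
  have h_deriv (z : ℂ) : HasDerivAt F (∑ i ∈ s, c i * (Complex.exp (z * t i) * t i)) z := by
    refine HasDerivAt.fun_sum fun i _ => HasDerivAt.const_mul (c i) ?_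
    simpa using ((hasDerivAt_id z).mul_const (t i : ℂ)).cexp
  have h_diff : Differentiable ℂ F := fun z => (h_deriv z).differentiableAt
  have h_bdd : BddAbove ((norm ∘ F) '' Complex.HadamardThreeLines.verticalClosedStrip 0 1) := by
    refine ⟨∑ i ∈ s, ‖c i‖ * Real.exp |t i|, ?_⟩
    rintro _ ⟨z, hz, rfl⟩
    refine (norm_sum_le _ _).trans (Finset.sum_le_sum fun i _ => ?_)
    rw [norm_mul, Complex.norm_exp, Complex.re_mul_ofReal]
    have hz' : 0 ≤ z.re ∧ z.re ≤ 1 := hz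
    gcongr
    calc z.re * t i ≤ |z.re * t i| := le_abs_self _
      _ = z.re * |t i| := by rw [abs_mul, abs_of_nonneg hz'.1]
      _ ≤ |t i| := mul_le_of_le_one_left (abs_nonneg _) hz'.2
  have h_interp (x : ℝ) (h0 : 0 ≤ x) (h1 : x ≤ 1) : (F x).re ≤ K ^ x := by
    have := Complex.HadamardThreeLines.norm_le_interp_of_mem_verticalClosedStrip₀₁' F (z := (x : ℂ))
      (a := 1) (b := K) (by exact ⟨by simpa using h0, by simpa using h1⟩) h_diff.diffContOnCl h_bdd
      (fun z hz => h_left z hz) (fun z hz => h_right z hz)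
    exact (Complex.re_le_norm _).trans (by simpa using this)
  have h_real : HasDerivAt (fun x : ℝ => K ^ x - (F x).re)
      (Real.log K - (∑ i ∈ s, c i * t i).re) 0 := by
    refine HasDerivAt.sub ?_ ?_
    · simpa using Real.hasStrictDerivAt_const_rpow hK 0 |>.hasDerivAt
    · have := (h_deriv ((0 : ℝ) : ℂ)).real_of_complex
      simpa using this
  have h_lim := h_real.tendsto_slope_zero_right
  refine sub_nonneg.mp (ge_of_tendsto h_lim ?_)
  filter_upwards [Ioo_mem_nhdsGT (zero_lt_one' ℝ)] with x hx
  have h1 := h_interp x hx.1.le hx.2.le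
  have h2 : F ((0 : ℝ) : ℂ) = 1 := by simp [hF, h_zero]
  simp only [zero_add, h2, Complex.one_re, Real.rpow_zero, sub_self, sub_zero, smul_eq_mul]
  exact mul_nonneg (inv_nonneg.mpr hx.1.le) (sub_nonneg.mpr h1)

namespace Matrix

variable {n : Type*} [Fintype n] [DecidableEq n]

theorem sum_norm_sq_sum_mul_of_mem_unitaryGroup {U : Matrix n n ℂ}
    (hU : U ∈ unitaryGroup n ℂ) (x : n → ℂ) :
    ∑ j, ‖∑ i, x i * U i j‖ ^ 2 = ∑ i, ‖x i‖ ^ 2 := by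
  have h : (x ᵥ* U) ⬝ᵥ star (x ᵥ* U) = x ⬝ᵥ star x := by
    rw [star_vecMul, ← dotProduct_mulVec, mulVec_mulVec, ← star_eq_conjTranspose,
      mem_unitaryGroup_iff.mp hU, one_mulVec]
  simp only [dotProduct, vecMul, Pi.star_apply, RCLike.star_def, Complex.mul_conj'] at h
  exact_mod_cast h

theorem sum_norm_sq_sum_mul_conj_of_mem_unitaryGroup {U : Matrix n n ℂ}
    (hU : U ∈ unitaryGroup n ℂ) (x : n → ℂ) :
    ∑ j, ‖∑ i, x i * conj (U i j)‖ ^ 2 = ∑ i, ‖x i‖ ^ 2 := by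
  have h := sum_norm_sq_sum_mul_of_mem_unitaryGroup hU (fun i => conj (x i))
  simp only [RCLike.norm_conj] at h
  rw [← h]
  refine Finset.sum_congr rfl fun j _ => ?_
  rw [← RCLike.norm_conj (∑ i, conj (x i) * U i j)]
  simp [map_sum]

theorem sum_norm_sq_col_of_mem_unitaryGroup {U : Matrix n n ℂ}
    (hU : U ∈ unitaryGroup n ℂ) (j : n) : ∑ i, ‖U i j‖ ^ 2 = 1 := by
  have h := congrFun (congrFun (mem_unitaryGroup_iff'.mp hU) j) j
  simp only [mul_apply, star_apply, RCLike.star_def, Complex.conj_mul', one_apply_eq] at h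
  exact_mod_cast h

theorem sum_mul_conj_of_mem_unitaryGroup {U : Matrix n n ℂ}
    (hU : U ∈ unitaryGroup n ℂ) (i i' : n) :
    ∑ j, U i j * conj (U i' j) = if i = i' then 1 else 0 := by
  simpa only [mul_apply, star_apply, RCLike.star_def, one_apply] using
    congrFun (congrFun (mem_unitaryGroup_iff.mp hU) i) i'

end Matrix

theorem sum_norm_mul_norm_le {ι : Type*} (s : Finset ι) (f g : ι → ℂ) {C : ℝ}
    (hf : ∑ i ∈ s, ‖f i‖ ^ 2 ≤ C) (hg : ∑ i ∈ s, ‖g i‖ ^ 2 ≤ C) :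
    ∑ i ∈ s, ‖f i‖ * ‖g i‖ ≤ C := by
  have h : ∑ i ∈ s, 2 * (‖f i‖ * ‖g i‖) ≤ ∑ i ∈ s, (‖f i‖ ^ 2 + ‖g i‖ ^ 2) :=
    Finset.sum_le_sum fun i _ => by linarith [two_mul_le_add_sq ‖f i‖ ‖g i‖]
  rw [← Finset.mul_sum, Finset.sum_add_distrib] at h
  linarith


namespace Matrix

variable {n : Type*} [Fintype n] {U V : Matrix n n ℂ} {l P Q : n → ℝ}

/-- The coefficients of the function `z ↦ Tr (ρ ^ (1 - z) P ^ (z / 2) Q ^ z P ^ (z / 2))`, where `ρ`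
has eigenvalues `l` and eigenvectors the columns of `V`, `P` is diagonal in the standard basis and
`Q` is diagonal in the basis formed by the columns of `U`. -/
noncomputable def interpolationCoeff (U V : Matrix n n ℂ) (l : n → ℝ) (s : n × n × n × n) : ℂ :=
  l s.1 * ((conj (V s.2.2.1 s.1) * U s.2.2.1 s.2.1) * (V s.2.2.2 s.1 * conj (U s.2.2.2 s.2.1)))

/-- The exponents matching `Matrix.interpolationCoeff`. -/
noncomputable def interpolationExponent (l P Q : n → ℝ) (s : n × n × n × n) : ℝ :=
  -Real.log (l s.1) + Real.log (Q s.2.1) + Real.log (P s.2.2.1) / 2 + Real.log (P s.2.2.2) / 2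

theorem sum_interpolationCoeff_mul_exp (z : ℂ) :
    ∑ s, interpolationCoeff U V l s * Complex.exp (z * interpolationExponent l P Q s) =
      ∑ k, ∑ j, l k * Complex.exp (z * ↑(-Real.log (l k))) * Complex.exp (z * Real.log (Q j)) *
        ((∑ i, conj (V i k) * Complex.exp (z * ↑(Real.log (P i) / 2)) * U i j) *
          ∑ i, V i k * Complex.exp (z * ↑(Real.log (P i) / 2)) * conj (U i j)) := by
  simp only [Fintype.sum_prod_type]
  refine Finset.sum_congr rfl fun k _ => Finset.sum_congr rfl fun j _ => ?_
  rw [Finset.sum_mul_sum]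
  simp only [Finset.mul_sum]
  refine Finset.sum_congr rfl fun i _ => Finset.sum_congr rfl fun i' _ => ?_
  simp only [interpolationCoeff, interpolationExponent, Complex.ofReal_add, mul_add, Complex.exp_add]
  ring

theorem sum_interpolationCoeff_eq_norm_sq (k j : n) :
    ∑ i, ∑ i', interpolationCoeff U V l (k, j, i, i') =
      ((l k * ‖∑ i, conj (V i k) * U i j‖ ^ 2 : ℝ) : ℂ) := by
  simp only [interpolationCoeff, ← Finset.mul_sum]
  rw [← Finset.sum_mul]
  push_cast
  rw [← Complex.mul_conj']
  simp only [map_sum, map_mul, Complex.conj_conj]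

theorem norm_exp_mul_ofReal_of_re_eq_zero {z : ℂ} (hz : z.re = 0) (t : ℝ) :
    ‖Complex.exp (z * t)‖ = 1 := by
  simp [Complex.norm_exp, hz]

theorem norm_exp_mul_ofReal_of_re_eq_one {z : ℂ} (hz : z.re = 1) (t : ℝ) :
    ‖Complex.exp (z * t)‖ = Real.exp t := by
  simp [Complex.norm_exp, hz]

variable [DecidableEq n]

theorem norm_sum_interpolationCoeff_mul_exp_le_one (hU : U ∈ unitaryGroup n ℂ)
    (hV : V ∈ unitaryGroup n ℂ) (hl : ∀ k, 0 ≤ l k) (hl1 : ∑ k, l k = 1)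
    {z : ℂ} (hz : z.re = 0) :
    ‖∑ s, interpolationCoeff U V l s * Complex.exp (z * interpolationExponent l P Q s)‖ ≤ 1 := by
  rw [sum_interpolationCoeff_mul_exp, ← hl1]
  refine (norm_sum_le _ _).trans (Finset.sum_le_sum fun k _ => (norm_sum_le _ _).trans ?_)
  simp only [norm_mul, norm_exp_mul_ofReal_of_re_eq_zero hz, mul_one, Complex.norm_real,
    Real.norm_of_nonneg (hl k), ← Finset.mul_sum]
  refine mul_le_of_le_one_right (hl k) (sum_norm_mul_norm_le _ _ _ (le_of_eq ?_) (le_of_eq ?_))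
  · rw [sum_norm_sq_sum_mul_of_mem_unitaryGroup hU, ← sum_norm_sq_col_of_mem_unitaryGroup hV k]
    simp only [norm_mul, RCLike.norm_conj, norm_exp_mul_ofReal_of_re_eq_zero hz, mul_one]
  · rw [sum_norm_sq_sum_mul_conj_of_mem_unitaryGroup hU, ← sum_norm_sq_col_of_mem_unitaryGroup hV k]
    simp only [norm_mul, norm_exp_mul_ofReal_of_re_eq_zero hz, mul_one]

theorem norm_sum_interpolationCoeff_mul_exp_le (hV : V ∈ unitaryGroup n ℂ)
    (hl : ∀ k, 0 ≤ l k) (hP : ∀ i, 0 < P i) (hQ : ∀ j, 0 < Q j)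
    {c : ℝ} (hc : ∀ i j, ‖U i j‖ ^ 2 ≤ c) {z : ℂ} (hz : z.re = 1) :
    ‖∑ s, interpolationCoeff U V l s * Complex.exp (z * interpolationExponent l P Q s)‖ ≤
      c * (∑ i, P i) * ∑ j, Q j := by
  have h_weight (k : n) : l k * Real.exp (-Real.log (l k)) ≤ 1 := by
    rcases (hl k).eq_or_lt with h | h
    · simp [← h]
    · rw [Real.exp_neg, Real.exp_log h, mul_inv_cancel₀ h.ne']
  have h_sq (i : n) : Real.exp (Real.log (P i) / 2) ^ 2 = P i := by
    rw [← Real.exp_nat_mul, Nat.cast_ofNat, mul_div_cancel₀ _ two_ne_zero, Real.exp_log (hP i)]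
  have h_col (j : n) : ∑ i, (Real.exp (Real.log (P i) / 2) * ‖U i j‖) ^ 2 ≤ c * ∑ i, P i := by
    rw [Finset.mul_sum]
    refine Finset.sum_le_sum fun i _ => ?_
    rw [mul_pow, h_sq, mul_comm]
    exact mul_le_mul_of_nonneg_right (hc i j) (hP i).le
  rw [sum_interpolationCoeff_mul_exp, Finset.sum_comm, Finset.mul_sum]
  refine (norm_sum_le _ _).trans (Finset.sum_le_sum fun j _ => (norm_sum_le _ _).trans ?_)
  set A : n → ℂ := fun k => ∑ i, conj (V i k) * Complex.exp (z * ↑(Real.log (P i) / 2)) * U i j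
  set B : n → ℂ := fun k => ∑ i, V i k * Complex.exp (z * ↑(Real.log (P i) / 2)) * conj (U i j)
  have hA : ∑ k, ‖A k‖ ^ 2 ≤ c * ∑ i, P i := by
    have h := sum_norm_sq_sum_mul_conj_of_mem_unitaryGroup hV
      fun i => Complex.exp (z * ↑(Real.log (P i) / 2)) * U i j
    simp only [norm_mul, norm_exp_mul_ofReal_of_re_eq_one hz] at h
    refine (le_of_eq ?_).trans (h.trans_le (h_col j))
    simp only [A, mul_assoc, mul_comm (conj _)]
  have hB : ∑ k, ‖B k‖ ^ 2 ≤ c * ∑ i, P i := by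
    have h := sum_norm_sq_sum_mul_of_mem_unitaryGroup hV
      fun i => Complex.exp (z * ↑(Real.log (P i) / 2)) * conj (U i j)
    simp only [norm_mul, norm_exp_mul_ofReal_of_re_eq_one hz, RCLike.norm_conj] at h
    refine (le_of_eq ?_).trans (h.trans_le (h_col j))
    simp only [B, mul_assoc, mul_comm (V _ _)]
  calc ∑ k, ‖l k * Complex.exp (z * ↑(-Real.log (l k))) * Complex.exp (z * Real.log (Q j)) *
          (A k * B k)‖
      ≤ ∑ k, Q j * (‖A k‖ * ‖B k‖) := by
        refine Finset.sum_le_sum fun k _ => ?_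
        simp only [norm_mul, norm_exp_mul_ofReal_of_re_eq_one hz, Complex.norm_real,
          Real.norm_of_nonneg (hl k), Real.exp_log (hQ j)]
        gcongr
        exact mul_le_of_le_one_left (hQ j).le (h_weight k)
    _ ≤ c * (∑ i, P i) * Q j := by
        rw [← Finset.mul_sum, mul_comm]
        exact mul_le_mul_of_nonneg_right (sum_norm_mul_norm_le _ _ _ hA hB) (hQ j).le

theorem sum_interpolationCoeff_left (hU : U ∈ unitaryGroup n ℂ) (k i : n) :
    ∑ j, ∑ i', interpolationCoeff U V l (k, j, i, i') = ((l k * ‖V i k‖ ^ 2 : ℝ) : ℂ) := by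
  rw [Finset.sum_comm]
  have h (i' : n) : ∑ j, interpolationCoeff U V l (k, j, i, i') =
      l k * (conj (V i k) * V i' k) * if i = i' then 1 else 0 := by
    rw [← sum_mul_conj_of_mem_unitaryGroup hU, Finset.mul_sum]
    exact Finset.sum_congr rfl fun j _ => by simp only [interpolationCoeff]; ring
  simp [h, Complex.conj_mul']

theorem sum_interpolationCoeff_right (hU : U ∈ unitaryGroup n ℂ) (k i' : n) :
    ∑ j, ∑ i, interpolationCoeff U V l (k, j, i, i') = ((l k * ‖V i' k‖ ^ 2 : ℝ) : ℂ) := by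
  rw [Finset.sum_comm]
  have h (i : n) : ∑ j, interpolationCoeff U V l (k, j, i, i') =
      l k * (conj (V i k) * V i' k) * if i = i' then 1 else 0 := by
    rw [← sum_mul_conj_of_mem_unitaryGroup hU, Finset.mul_sum]
    exact Finset.sum_congr rfl fun j _ => by simp only [interpolationCoeff]; ring
  simp [h, Complex.conj_mul']

theorem sum_interpolationCoeff_fst (hU : U ∈ unitaryGroup n ℂ) (hV : V ∈ unitaryGroup n ℂ)
    (k : n) : ∑ j, ∑ i, ∑ i', interpolationCoeff U V l (k, j, i, i') = l k := by
  rw [Finset.sum_comm]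
  simp only [sum_interpolationCoeff_left hU]
  rw [← Complex.ofReal_sum, ← Finset.mul_sum, sum_norm_sq_col_of_mem_unitaryGroup hV, mul_one]

theorem sum_interpolationCoeff_mul_exponent (hU : U ∈ unitaryGroup n ℂ)
    (hV : V ∈ unitaryGroup n ℂ) :
    ∑ s, interpolationCoeff U V l s * interpolationExponent l P Q s =
      ((-∑ k, l k * Real.log (l k) + ∑ i, (∑ k, l k * ‖V i k‖ ^ 2) * Real.log (P i) +
        ∑ j, (∑ k, l k * ‖∑ i, conj (V i k) * U i j‖ ^ 2) * Real.log (Q j) : ℝ) : ℂ) := by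
  have hl : ∑ k, ∑ j, ∑ i, ∑ i', interpolationCoeff U V l (k, j, i, i') * Real.log (l k) =
      ((∑ k, l k * Real.log (l k) : ℝ) : ℂ) := by
    simp only [← Finset.sum_mul, sum_interpolationCoeff_fst hU hV]
    push_cast; rfl
  have hQ : ∑ k, ∑ j, ∑ i, ∑ i', interpolationCoeff U V l (k, j, i, i') * Real.log (Q j) =
      ((∑ j, (∑ k, l k * ‖∑ i, conj (V i k) * U i j‖ ^ 2) * Real.log (Q j) : ℝ) : ℂ) := by
    simp only [← Finset.sum_mul, sum_interpolationCoeff_eq_norm_sq]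
    rw [Finset.sum_comm]
    simp only [← Finset.sum_mul]
    push_cast; rfl
  have hP : ∑ k, ∑ j, ∑ i, ∑ i', interpolationCoeff U V l (k, j, i, i') * Real.log (P i) =
      ((∑ i, (∑ k, l k * ‖V i k‖ ^ 2) * Real.log (P i) : ℝ) : ℂ) := by
    simp only [← Finset.sum_mul]
    have h (k : n) : ∑ j, ∑ i, (∑ i', interpolationCoeff U V l (k, j, i, i')) * Real.log (P i) =
        ∑ i, ((l k * ‖V i k‖ ^ 2 : ℝ) : ℂ) * Real.log (P i) := by
      rw [Finset.sum_comm]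
      simp only [← Finset.sum_mul, sum_interpolationCoeff_left hU]
    simp only [h]
    rw [Finset.sum_comm]
    simp only [← Finset.sum_mul]
    push_cast; rfl
  have hP' : ∑ k, ∑ j, ∑ i, ∑ i', interpolationCoeff U V l (k, j, i, i') * Real.log (P i') =
      ((∑ i, (∑ k, l k * ‖V i k‖ ^ 2) * Real.log (P i) : ℝ) : ℂ) := by
    have h (k : n) : ∑ j, ∑ i, ∑ i', interpolationCoeff U V l (k, j, i, i') * Real.log (P i') =
        ∑ i, ((l k * ‖V i k‖ ^ 2 : ℝ) : ℂ) * Real.log (P i) := by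
      have h' (j : n) : ∑ i, ∑ i', interpolationCoeff U V l (k, j, i, i') * Real.log (P i') =
          ∑ i', (∑ i, interpolationCoeff U V l (k, j, i, i')) * Real.log (P i') := by
        rw [Finset.sum_comm]
        simp only [← Finset.sum_mul]
      simp only [h']
      rw [Finset.sum_comm]
      simp only [← Finset.sum_mul, sum_interpolationCoeff_right hU]
    simp only [h]
    rw [Finset.sum_comm]
    simp only [← Finset.sum_mul]
    push_cast; rfl
  have h_split (s : n × n × n × n) : interpolationCoeff U V l s * interpolationExponent l P Q s =
      -(interpolationCoeff U V l s * Real.log (l s.1)) +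
        interpolationCoeff U V l s * Real.log (Q s.2.1) +
        interpolationCoeff U V l s * Real.log (P s.2.2.1) / 2 +
        interpolationCoeff U V l s * Real.log (P s.2.2.2) / 2 := by
    simp only [interpolationExponent]
    push_cast
    ring
  simp only [h_split, Finset.sum_add_distrib, Finset.sum_neg_distrib, ← Finset.sum_div,
    Fintype.sum_prod_type, hl, hQ, hP, hP']
  push_cast
  ring

/-- The Gibbs-type form of the mixed-state Maassen–Uffink bound, with arbitrary positive weights
`P` and `Q` inside the logarithms. -/
theorem sum_mul_log_add_sum_mul_log_le [Nonempty n] (hU : U ∈ unitaryGroup n ℂ)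
    (hV : V ∈ unitaryGroup n ℂ) (hl : ∀ k, 0 ≤ l k) (hl1 : ∑ k, l k = 1)
    (hP : ∀ i, 0 < P i) (hQ : ∀ j, 0 < Q j)
    {c : ℝ} (hc0 : 0 < c) (hc : ∀ i j, ‖U i j‖ ^ 2 ≤ c) :
    -∑ k, l k * Real.log (l k) + ∑ i, (∑ k, l k * ‖V i k‖ ^ 2) * Real.log (P i) +
        ∑ j, (∑ k, l k * ‖∑ i, conj (V i k) * U i j‖ ^ 2) * Real.log (Q j) ≤
      Real.log (c * (∑ i, P i) * ∑ j, Q j) := by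
  have hK : 0 < c * (∑ i, P i) * ∑ j, Q j :=
    mul_pos (mul_pos hc0 (Finset.sum_pos (fun i _ => hP i) Finset.univ_nonempty))
      (Finset.sum_pos (fun j _ => hQ j) Finset.univ_nonempty)
  have h_zero : ∑ s, interpolationCoeff U V l s = 1 := by
    simp only [Fintype.sum_prod_type, sum_interpolationCoeff_fst hU hV]
    exact_mod_cast hl1
  have h := re_sum_mul_le_log_of_norm_le Finset.univ (interpolationCoeff U V l)
    (interpolationExponent l P Q) hK h_zero
    (fun z hz => norm_sum_interpolationCoeff_mul_exp_le_one hU hV hl hl1 hz)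
    (fun z hz => norm_sum_interpolationCoeff_mul_exp_le hV hl hP hQ hc hz)
  rwa [sum_interpolationCoeff_mul_exponent hU hV, Complex.ofReal_re] at h

end Matrix

theorem tendsto_sum_mul_log_add {ι : Type*} [Fintype ι] (p : ι → ℝ) :
    Filter.Tendsto (fun ε : ℝ => ∑ i, p i * Real.log (p i + ε)) (nhdsWithin 0 (Set.Ioi 0))
      (nhds (∑ i, p i * Real.log (p i))) := by
  refine tendsto_finsetSum _ fun i _ => ?_
  rcases eq_or_ne (p i) 0 with h | h
  · simp [h]
  · have : ContinuousAt (fun ε : ℝ => p i * Real.log (p i + ε)) 0 :=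
      continuousAt_const.mul ((continuousAt_const.add continuousAt_id).log (by simpa using h))
    simpa using this.tendsto.mono_left nhdsWithin_le_nhds

theorem Matrix.IsHermitian.apply_eq_sum_eigenvalues {n : Type*} [Fintype n] [DecidableEq n]
    {A : Matrix n n ℂ} (hA : A.IsHermitian) (i j : n) :
    A i j = ∑ k, (hA.eigenvectorUnitary : Matrix n n ℂ) i k * hA.eigenvalues k *
      conj ((hA.eigenvectorUnitary : Matrix n n ℂ) j k) := by
  conv_lhs => rw [hA.spectral_theorem, Unitary.conjStarAlgAut_apply]
  simp [Matrix.mul_apply, Matrix.diagonal_apply]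

/-- Mixed-state Maassen–Uffink bound: `H(p) + H(q) ≥ -ln c₁ + S(ρ)`, where
`c₁ = max_{i,j} |U i j|²`. -/
theorem stmt_4 (d : ℕ) (hd : 2 ≤ d)
    (U : Matrix (Fin d) (Fin d) ℂ) (hU : U ∈ Matrix.unitaryGroup (Fin d) ℂ)
    (ρ : Matrix (Fin d) (Fin d) ℂ) (hρ : ρ.PosSemidef) (hρtr : ρ.trace = 1)
    (p q : Fin d → ℝ)
    (hp : ∀ i, p i = (ρ i i).re)
    (hq : ∀ j, q j = ((Uᴴ * ρ * U) j j).re)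
    (c1 : ℝ) (hc1 : IsGreatest { r : ℝ | ∃ i j, r = ‖U i j‖ ^ 2 } c1) :
    shannonEntropy p + shannonEntropy q ≥
      -Real.log c1 + vonNeumannEntropy hρ.isHermitian := by
  have : Nonempty (Fin d) := ⟨⟨0, by omega⟩⟩
  set l := hρ.isHermitian.eigenvalues
  set V : Matrix (Fin d) (Fin d) ℂ := hρ.isHermitian.eigenvectorUnitary.1
  have hV : V ∈ Matrix.unitaryGroup (Fin d) ℂ := hρ.isHermitian.eigenvectorUnitary.2
  have hρ_apply (i j : Fin d) : ρ i j = ∑ k, V i k * l k * conj (V j k) :=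
    hρ.isHermitian.apply_eq_sum_eigenvalues i j
  have hl (k : Fin d) : 0 ≤ l k := hρ.eigenvalues_nonneg k
  have hl1 : ∑ k, l k = 1 := by
    have h : ∑ k, (l k : ℂ) = 1 := hρ.isHermitian.trace_eq_sum_eigenvalues.symm.trans hρtr
    exact_mod_cast h
  have hp' (i : Fin d) : ∑ k, l k * ‖V i k‖ ^ 2 = p i := by
    rw [hp, hρ_apply, ← Complex.ofReal_re (∑ k, _)]
    congr 1
    push_cast
    refine Finset.sum_congr rfl fun k _ => ?_
    rw [← Complex.mul_conj']
    ring
  have hq' (j : Fin d) : ∑ k, l k * ‖∑ i, conj (V i k) * U i j‖ ^ 2 = q j := by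
    rw [hq, ← Complex.ofReal_re (∑ k, _)]
    congr 1
    push_cast
    simp only [← Complex.conj_mul', map_sum, map_mul, Complex.conj_conj, Finset.mul_sum,
      Matrix.mul_apply, Matrix.conjTranspose_apply, RCLike.star_def,
      Finset.sum_mul, hρ_apply]
    rw [Finset.sum_comm]
    refine Finset.sum_congr rfl fun i _ => ?_
    rw [Finset.sum_comm]
    refine Finset.sum_congr rfl fun i' _ => Finset.sum_congr rfl fun k _ => ?_
    ring
  have hp1 : ∑ i, p i = 1 := by
    simp only [hp, ← Complex.re_sum]
    exact congrArg Complex.re hρtr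
  have hq1 : ∑ j, q j = 1 := by
    have h : (Uᴴ * ρ * U).trace = 1 := by
      rw [Matrix.trace_mul_comm, ← Matrix.mul_assoc, ← Matrix.star_eq_conjTranspose,
        Matrix.mem_unitaryGroup_iff.mp hU, Matrix.one_mul, hρtr]
    simp only [hq, ← Complex.re_sum]
    exact congrArg Complex.re h
  have hp0 (i : Fin d) : 0 ≤ p i := by
    rw [← hp']
    exact Finset.sum_nonneg fun k _ => mul_nonneg (hl k) (sq_nonneg _)
  have hq0 (j : Fin d) : 0 ≤ q j := by
    rw [← hq']
    exact Finset.sum_nonneg fun k _ => mul_nonneg (hl k) (sq_nonneg _)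
  have hc (i j : Fin d) : ‖U i j‖ ^ 2 ≤ c1 := hc1.2 ⟨i, j, rfl⟩
  have hc0 : 0 < c1 := by
    by_contra! h
    have h1 := Matrix.sum_norm_sq_col_of_mem_unitaryGroup hU ⟨0, by omega⟩
    have h2 : ∑ i, ‖U i ⟨0, by omega⟩‖ ^ 2 ≤ 0 :=
      Finset.sum_nonpos fun i _ => (hc i _).trans h
    linarith
  have h_le (ε : ℝ) (hε : 0 < ε) :
      -∑ k, l k * Real.log (l k) + ∑ i, p i * Real.log (p i + ε) +
        ∑ j, q j * Real.log (q j + ε) ≤ Real.log (c1 * (1 + d * ε) * (1 + d * ε)) := by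
    have h := Matrix.sum_mul_log_add_sum_mul_log_le hU hV hl hl1
      (fun i => add_pos_of_nonneg_of_pos (hp0 i) hε)
      (fun j => add_pos_of_nonneg_of_pos (hq0 j) hε) hc0 hc
    simpa [hp', hq', Finset.sum_add_distrib, hp1, hq1] using h
  have h_right : Filter.Tendsto (fun ε : ℝ => Real.log (c1 * (1 + d * ε) * (1 + d * ε)))
      (nhdsWithin 0 (Set.Ioi 0)) (nhds (Real.log c1)) := by
    have h : ContinuousAt (fun ε : ℝ => Real.log (c1 * (1 + d * ε) * (1 + d * ε))) 0 :=
      ContinuousAt.log (by fun_prop) (by simpa using hc0.ne')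
    simpa using h.tendsto.mono_left nhdsWithin_le_nhds
  have h_main := le_of_tendsto_of_tendsto
    (((tendsto_const_nhds (x := -∑ k, l k * Real.log (l k))).add
      (tendsto_sum_mul_log_add p)).add (tendsto_sum_mul_log_add q)) h_right
    (Filter.eventually_of_mem self_mem_nhdsWithin h_le)
  simp only [shannonEntropy, vonNeumannEntropy]
  linarith
end

section
/- (Direct-sum majorization entropic uncertainty relation, Shannon case) For any density matrix ρ and any d×d unitary matrix U relating two orthonormal bases, with induced probability vectors p and q, one has H(p) + H(q) ≥ H(W), where W = (s₁, s₂−s₁, …, s_d−s_{d−1}). -/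
open scoped BigOperators Matrix ComplexConjugate ComplexOrder

/-- The operator norm (largest singular value) of the submatrix of `U` with rows `I`
and columns `J`, expressed as the supremum of `|⟨x, U y⟩|` over unit vectors supported
on `I` resp. `J`. -/
noncomputable def subOpNorm {d : ℕ} (U : Matrix (Fin d) (Fin d) ℂ)
    (I J : Finset (Fin d)) : ℝ :=
  sSup { r : ℝ | ∃ (x : I → ℂ) (y : J → ℂ),
    (∑ i, ‖x i‖ ^ 2 = 1) ∧ (∑ j, ‖y j‖ ^ 2 = 1) ∧
    r = ‖∑ i : I, ∑ j : J, (starRingEnd ℂ) (x i) * U i.1 j.1 * y j‖ }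

/-- `sCoef U k` is the coefficient `s_k`: the maximal operator norm of a submatrix of `U`
of class `k`, i.e. with `#rows + #cols = k + 1` (for `k = 0` the set is empty and the
supremum equals `0`). -/
noncomputable def sCoef {d : ℕ} (U : Matrix (Fin d) (Fin d) ℂ) (k : ℕ) : ℝ :=
  sSup { r : ℝ | ∃ I J : Finset (Fin d), I.Nonempty ∧ J.Nonempty ∧
    I.card + J.card = k + 1 ∧ r = subOpNorm U I J }

/-- The vector `W = (s₁, s₂ - s₁, …, s_d - s_{d-1})`. -/
noncomputable def Wvec {d : ℕ} (U : Matrix (Fin d) (Fin d) ℂ) : Fin d → ℝ :=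
  fun k => sCoef U (k.val + 1) - (if k.val = 0 then 0 else sCoef U k.val)

/-- A weighted sum with antitone weights is bounded below by the last weight times the total,
provided all partial sums are nonnegative. -/
lemma mul_sum_range_le_sum_range_mul_of_antitone {a g : ℕ → ℝ} (hg : Antitone g) (n : ℕ)
    (h : ∀ m ≤ n, 0 ≤ ∑ i ∈ Finset.range m, a i) :
    g n * ∑ i ∈ Finset.range n, a i ≤ ∑ i ∈ Finset.range n, a i * g i := by
  induction n with
  | zero => simp
  | succ n ih =>
    have ih := ih fun m hm => h m (hm.trans n.le_succ)
    have hS := h (n + 1) le_rfl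
    have hS' := h n n.le_succ
    have hle : g (n + 1) ≤ g n := hg n.le_succ
    have key := mul_le_mul_of_nonneg_right hle hS
    rw [Finset.sum_range_succ] at hS key ⊢
    rw [Finset.sum_range_succ]
    linarith

/-- The tangent-line inequality for `x ↦ x * log x`. -/
lemma mul_log_add_sub_le_mul_log {w t : ℝ} (hw : 0 ≤ w) (ht : 0 < t) :
    w * Real.log t + w - t ≤ w * Real.log w := by
  rcases hw.eq_or_lt with rfl | hw
  · simp [ht.le]
  · have h := Real.log_le_sub_one_of_pos (div_pos ht hw)
    rw [Real.log_div ht.ne' hw.ne'] at h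
    have h' := mul_le_mul_of_nonneg_left h hw.le
    have : w * (t / w - 1) = t - w := by field_simp
    linarith

/-- A real tuple over a finite type can be enumerated in decreasing order. -/
lemma exists_equiv_fin_antitone {ι : Type*} [Fintype ι] (z : ι → ℝ) :
    ∃ e : Fin (Fintype.card ι) ≃ ι, Antitone (z ∘ e) := by
  let f : Fin (Fintype.card ι) → ℝ := fun i => -z ((Fintype.equivFin ι).symm i)
  refine ⟨(Tuple.sort f).trans (Fintype.equivFin ι).symm, fun i j hij => ?_⟩
  have := Tuple.monotone_sort f hij
  simpa [f] using this

/-- Schur convexity of `∑ x log x`: the sequence `w` majorizes the tuple `z`. -/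
lemma sum_mul_log_le_of_majorized {ι : Type*} [Fintype ι] {z : ι → ℝ} {w : ℕ → ℝ}
    (hz : ∀ i, 0 ≤ z i) (hw : ∀ i, 0 ≤ w i)
    (hle : ∀ s : Finset ι, ∑ i ∈ s, z i ≤ ∑ i ∈ Finset.range s.card, w i)
    (heq : ∑ i, z i = ∑ i ∈ Finset.range (Fintype.card ι), w i) :
    ∑ i, z i * Real.log (z i) ≤
      ∑ i ∈ Finset.range (Fintype.card ι), w i * Real.log (w i) := by
  obtain ⟨e, he⟩ := exists_equiv_fin_antitone z
  generalize Fintype.card ι = N at *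
  let y : ℕ → ℝ := fun i => if h : i < N then z (e ⟨i, h⟩) else 0
  have hy : ∀ i, 0 ≤ y i := fun i => by
    by_cases h : i < N <;> simp [y, h, hz]
  have hyanti : Antitone y := fun i j hij => by
    by_cases hj : j < N
    · have hi : i < N := hij.trans_lt hj
      simpa [y, hi, hj] using he (show (⟨i, hi⟩ : Fin N) ≤ ⟨j, hj⟩ from hij)
    · simpa [y, hj] using hy i
  have hsum : ∀ F : ℝ → ℝ, ∑ i, F (z i) = ∑ i ∈ Finset.range N, F (y i) := fun F => by
    rw [Finset.sum_range, ← e.sum_comp]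
    exact Finset.sum_congr rfl fun i _ => by simp [y]
  have hpartial : ∀ m ≤ N, ∑ i ∈ Finset.range m, y i ≤ ∑ i ∈ Finset.range m, w i := by
    intro m hm
    have h := hle ((Finset.univ : Finset (Fin m)).map
      ((Fin.castLEEmb hm).trans e.toEmbedding))
    rw [Finset.sum_map, Finset.card_map, Finset.card_univ, Fintype.card_fin] at h
    refine le_trans (le_of_eq ?_) h
    rw [Finset.sum_range]
    refine Finset.sum_congr rfl fun i _ => ?_
    have : (i : ℕ) < N := i.2.trans_le hm
    simp [y, this, Fin.castLE]
  have htot : ∑ i ∈ Finset.range N, y i = ∑ i ∈ Finset.range N, w i := by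
    rw [← heq]; exact (hsum id).symm
  rw [hsum fun x => x * Real.log x]
  refine le_of_forall_pos_le_add fun δ hδ => ?_
  let ε := δ / (N + 1)
  have hN0 : (0 : ℝ) < N + 1 := by positivity
  have hε : 0 < ε := div_pos hδ hN0
  have hNε : N * ε ≤ δ := by
    have : (N + 1) * ε = δ := by simp only [ε]; field_simp
    linarith
  have hg : Antitone fun i => Real.log (y i + ε) := fun i j hij =>
    Real.log_le_log (by linarith [hy j]) (by linarith [hyanti hij])
  have habel := mul_sum_range_le_sum_range_mul_of_antitone (a := fun i => w i - y i) hg N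
    fun m hm => by
      rw [Finset.sum_sub_distrib]; linarith [hpartial m hm]
  rw [Finset.sum_sub_distrib, htot, sub_self, mul_zero] at habel
  calc ∑ i ∈ Finset.range N, y i * Real.log (y i)
      ≤ ∑ i ∈ Finset.range N, y i * Real.log (y i + ε) := by
        refine Finset.sum_le_sum fun i _ => ?_
        rcases (hy i).eq_or_lt with h | h
        · simp [← h]
        · exact mul_le_mul_of_nonneg_left (Real.log_le_log h (by linarith)) h.le
    _ ≤ ∑ i ∈ Finset.range N, w i * Real.log (y i + ε) := by
        simp only [sub_mul, Finset.sum_sub_distrib] at habel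
        linarith
    _ = ∑ i ∈ Finset.range N, (w i * Real.log (y i + ε) + w i - (y i + ε)) + N * ε := by
        simp only [Finset.sum_sub_distrib, Finset.sum_add_distrib, htot, Finset.sum_const,
          Finset.card_range, nsmul_eq_mul]
        ring
    _ ≤ ∑ i ∈ Finset.range N, w i * Real.log (w i) + δ := by
        refine add_le_add (Finset.sum_le_sum fun i _ => ?_) hNε
        exact mul_log_add_sub_le_mul_log (hw i) (by linarith [hy i])

/-- Cauchy–Schwarz for complex tuples, squared form. -/
lemma norm_sum_conj_mul_sq_le {n : Type*} [Fintype n] (x y : n → ℂ) :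
    ‖∑ i, conj (x i) * y i‖ ^ 2 ≤ (∑ i, ‖x i‖ ^ 2) * ∑ i, ‖y i‖ ^ 2 := by
  have h : ‖∑ i, conj (x i) * y i‖ ≤ ∑ i, ‖x i‖ * ‖y i‖ :=
    (norm_sum_le _ _).trans (le_of_eq (by simp))
  exact (pow_le_pow_left₀ (norm_nonneg _) h 2).trans (Finset.sum_mul_sq_le_sq_mul_sq _ _ _)

section Unitary

variable {d : ℕ} {U : Matrix (Fin d) (Fin d) ℂ}

/-- The squared Euclidean norm as a dot product. -/
lemma ofReal_sum_norm_sq {n : Type*} [Fintype n] (x : n → ℂ) :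
    ((∑ i, ‖x i‖ ^ 2 : ℝ) : ℂ) = star x ⬝ᵥ x := by
  simp [dotProduct, Complex.conj_mul']

lemma sum_norm_sq_mulVec (hU : U ∈ Matrix.unitaryGroup (Fin d) ℂ) (y : Fin d → ℂ) :
    ∑ i, ‖(U *ᵥ y) i‖ ^ 2 = ∑ i, ‖y i‖ ^ 2 := by
  have h : Uᴴ * U = 1 := Matrix.mem_unitaryGroup_iff'.mp hU
  apply Complex.ofReal_injective
  rw [ofReal_sum_norm_sq, ofReal_sum_norm_sq, Matrix.star_mulVec, ← Matrix.dotProduct_mulVec,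
    Matrix.mulVec_mulVec, h, Matrix.one_mulVec]

/-- The sesquilinear form of a submatrix, in terms of vectors of the full space supported on the
given index sets. -/
lemma subOpNorm_eq_sSup_supported (U : Matrix (Fin d) (Fin d) ℂ) (I J : Finset (Fin d)) :
    subOpNorm U I J = sSup { r : ℝ | ∃ x y : Fin d → ℂ,
      (∀ i ∉ I, x i = 0) ∧ (∀ j ∉ J, y j = 0) ∧
      (∑ i, ‖x i‖ ^ 2 = 1) ∧ (∑ j, ‖y j‖ ^ 2 = 1) ∧
      r = ‖∑ i, conj (x i) * (U *ᵥ y) i‖ } := by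
  have key : ∀ x y : Fin d → ℂ, (∀ i ∉ I, x i = 0) → (∀ j ∉ J, y j = 0) →
      (∑ i : I, ‖x i‖ ^ 2 = ∑ i, ‖x i‖ ^ 2) ∧ (∑ j : J, ‖y j‖ ^ 2 = ∑ j, ‖y j‖ ^ 2) ∧
      ∑ i : I, ∑ j : J, conj (x i) * U i.1 j.1 * y j =
        ∑ i, conj (x i) * (U *ᵥ y) i := by
    intro x y hx hy
    refine ⟨?_, ?_, ?_⟩
    · rw [Finset.sum_coe_sort I fun i => ‖x i‖ ^ 2]
      exact Finset.sum_subset (Finset.subset_univ _) fun i _ hi => by simp [hx i hi]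
    · rw [Finset.sum_coe_sort J fun i => ‖y i‖ ^ 2]
      exact Finset.sum_subset (Finset.subset_univ _) fun i _ hi => by simp [hy i hi]
    · rw [Finset.sum_coe_sort I fun i => ∑ j : J, conj (x i) * U i j.1 * y j,
        Finset.sum_subset (Finset.subset_univ I) fun i _ hi => by simp [hx i hi]]
      refine Finset.sum_congr rfl fun i _ => ?_
      rw [Finset.sum_coe_sort J fun j => conj (x i) * U i j * y j,
        Finset.sum_subset (Finset.subset_univ J) fun i _ hi => by simp [hy i hi]]
      simp [Matrix.mulVec, dotProduct, Finset.mul_sum, mul_assoc]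
  unfold subOpNorm
  congr 1
  ext r
  constructor
  · rintro ⟨x, y, hx, hy, rfl⟩
    let x' : Fin d → ℂ := fun i => if h : i ∈ I then x ⟨i, h⟩ else 0
    let y' : Fin d → ℂ := fun j => if h : j ∈ J then y ⟨j, h⟩ else 0
    have hx0 : ∀ i ∉ I, x' i = 0 := fun i hi => by simp [x', hi]
    have hy0 : ∀ j ∉ J, y' j = 0 := fun j hj => by simp [y', hj]
    have hxr : x = fun i : I => x' i := by ext i; simp [x']
    have hyr : y = fun j : J => y' j := by ext j; simp [y']
    obtain ⟨h1, h2, h3⟩ := key x' y' hx0 hy0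
    rw [hxr] at hx
    rw [hyr] at hy
    exact ⟨x', y', hx0, hy0, h1 ▸ hx, h2 ▸ hy, by rw [← h3, hxr, hyr]⟩
  · rintro ⟨x, y, hx0, hy0, hx, hy, rfl⟩
    obtain ⟨h1, h2, h3⟩ := key x y hx0 hy0
    exact ⟨fun i => x i, fun j => y j, h1.trans hx, h2.trans hy, by rw [h3]⟩

lemma norm_sum_conj_mul_mulVec_le_one (hU : U ∈ Matrix.unitaryGroup (Fin d) ℂ)
    {x y : Fin d → ℂ} (hx : ∑ i, ‖x i‖ ^ 2 = 1) (hy : ∑ j, ‖y j‖ ^ 2 = 1) :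
    ‖∑ i, conj (x i) * (U *ᵥ y) i‖ ≤ 1 := by
  have h := norm_sum_conj_mul_sq_le x (U *ᵥ y)
  rw [sum_norm_sq_mulVec hU, hx, hy, mul_one] at h
  exact (sq_le_one_iff₀ (norm_nonneg _)).mp h

lemma norm_sum_conj_mul_mulVec_le_subOpNorm (hU : U ∈ Matrix.unitaryGroup (Fin d) ℂ)
    {I J : Finset (Fin d)} {x y : Fin d → ℂ} (hxI : ∀ i ∉ I, x i = 0) (hyJ : ∀ j ∉ J, y j = 0)
    (hx : ∑ i, ‖x i‖ ^ 2 = 1) (hy : ∑ j, ‖y j‖ ^ 2 = 1) :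
    ‖∑ i, conj (x i) * (U *ᵥ y) i‖ ≤ subOpNorm U I J := by
  rw [subOpNorm_eq_sSup_supported]
  refine le_csSup ⟨1, ?_⟩ ⟨x, y, hxI, hyJ, hx, hy, rfl⟩
  rintro _ ⟨x, y, -, -, hx, hy, rfl⟩
  exact norm_sum_conj_mul_mulVec_le_one hU hx hy

lemma subOpNorm_nonneg (U : Matrix (Fin d) (Fin d) ℂ) (I J : Finset (Fin d)) :
    0 ≤ subOpNorm U I J := by
  refine Real.sSup_nonneg ?_
  rintro _ ⟨x, y, -, -, rfl⟩
  exact norm_nonneg _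

lemma subOpNorm_le_one (hU : U ∈ Matrix.unitaryGroup (Fin d) ℂ) (I J : Finset (Fin d)) :
    subOpNorm U I J ≤ 1 := by
  rw [subOpNorm_eq_sSup_supported]
  refine Real.sSup_le ?_ zero_le_one
  rintro _ ⟨x, y, -, -, hx, hy, rfl⟩
  exact norm_sum_conj_mul_mulVec_le_one hU hx hy

lemma subOpNorm_mono (hU : U ∈ Matrix.unitaryGroup (Fin d) ℂ) {I I' J J' : Finset (Fin d)}
    (hI : I ⊆ I') (hJ : J ⊆ J') : subOpNorm U I J ≤ subOpNorm U I' J' := by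
  rw [subOpNorm_eq_sSup_supported U I J]
  refine Real.sSup_le ?_ (subOpNorm_nonneg _ _ _)
  rintro _ ⟨x, y, hxI, hyJ, hx, hy, rfl⟩
  exact norm_sum_conj_mul_mulVec_le_subOpNorm hU (fun i hi => hxI i fun h => hi (hI h))
    (fun j hj => hyJ j fun h => hj (hJ h)) hx hy

/-- The bilinear bound defining the operator norm, for vectors that need not be normalized. -/
lemma norm_sum_conj_mul_mulVec_le_mul_sqrt (hU : U ∈ Matrix.unitaryGroup (Fin d) ℂ)
    {I J : Finset (Fin d)} {x y : Fin d → ℂ} (hxI : ∀ i ∉ I, x i = 0) (hyJ : ∀ j ∉ J, y j = 0) :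
    ‖∑ i, conj (x i) * (U *ᵥ y) i‖ ≤
      subOpNorm U I J * (√(∑ i, ‖x i‖ ^ 2) * √(∑ j, ‖y j‖ ^ 2)) := by
  set a := √(∑ i, ‖x i‖ ^ 2) with ha
  set b := √(∑ j, ‖y j‖ ^ 2) with hb
  have ha2 : a ^ 2 = ∑ i, ‖x i‖ ^ 2 := Real.sq_sqrt (by positivity)
  have hb2 : b ^ 2 = ∑ j, ‖y j‖ ^ 2 := Real.sq_sqrt (by positivity)
  rcases eq_or_ne (a * b) 0 with h0 | h0
  · have h := norm_sum_conj_mul_sq_le x (U *ᵥ y)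
    rw [sum_norm_sq_mulVec hU, ← ha2, ← hb2, ← mul_pow, h0] at h
    rw [h0, mul_zero]
    nlinarith [norm_nonneg (∑ i, conj (x i) * (U *ᵥ y) i)]
  · obtain ⟨ha0, hb0⟩ := mul_ne_zero_iff.mp h0
    have ha' : 0 ≤ a := Real.sqrt_nonneg _
    have hb' : 0 ≤ b := Real.sqrt_nonneg _
    have hnorm : ∀ (v : Fin d → ℂ) (c : ℝ), c ≠ 0 → c ^ 2 = ∑ i, ‖v i‖ ^ 2 →
        ∑ i, ‖(((c⁻¹ : ℝ) : ℂ) • v) i‖ ^ 2 = 1 := by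
      intro v c hc hv
      simp only [Pi.smul_apply, norm_smul, mul_pow, ← Finset.mul_sum, ← hv]
      simp [hc]
    have h := norm_sum_conj_mul_mulVec_le_subOpNorm hU
      (I := I) (J := J) (x := ((a⁻¹ : ℝ) : ℂ) • x) (y := ((b⁻¹ : ℝ) : ℂ) • y)
      (fun i hi => by simp [hxI i hi]) (fun j hj => by simp [hyJ j hj])
      (hnorm x a ha0 ha2) (hnorm y b hb0 hb2)
    have hs : ∑ i, conj ((((a⁻¹ : ℝ) : ℂ) • x) i) * (U *ᵥ (((b⁻¹ : ℝ) : ℂ) • y)) i =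
        (((a * b)⁻¹ : ℝ) : ℂ) * ∑ i, conj (x i) * (U *ᵥ y) i := by
      rw [Matrix.mulVec_smul, Finset.mul_sum]
      refine Finset.sum_congr rfl fun i _ => ?_
      simp only [Pi.smul_apply, smul_eq_mul, map_mul, Complex.conj_ofReal, mul_inv,
        Complex.ofReal_mul]
      ring
    have hab : 0 < a * b := lt_of_le_of_ne (mul_nonneg ha' hb') h0.symm
    rw [hs, norm_mul, Complex.norm_real, Real.norm_of_nonneg (inv_nonneg.mpr hab.le),
      inv_mul_le_iff₀ hab] at h
    linarith

/-- Two-projection bound for a pure (not necessarily normalized) state. -/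
lemma sum_norm_sq_add_sum_norm_sq_le (hU : U ∈ Matrix.unitaryGroup (Fin d) ℂ)
    (I J : Finset (Fin d)) (ψ : Fin d → ℂ) :
    ∑ i ∈ I, ‖ψ i‖ ^ 2 + ∑ j ∈ J, ‖(Uᴴ *ᵥ ψ) j‖ ^ 2 ≤
      (1 + subOpNorm U I J) * ∑ i, ‖ψ i‖ ^ 2 := by
  set s := subOpNorm U I J
  have hs : 0 ≤ s := subOpNorm_nonneg U I J
  let c := Uᴴ *ᵥ ψ
  let x : Fin d → ℂ := fun i => if i ∈ I then ψ i else 0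
  let y : Fin d → ℂ := fun j => if j ∈ J then c j else 0
  set a := ∑ i ∈ I, ‖ψ i‖ ^ 2
  set b := ∑ j ∈ J, ‖(Uᴴ *ᵥ ψ) j‖ ^ 2
  have hx : ∑ i, ‖x i‖ ^ 2 = a := by
    simp [x, a, apply_ite, ite_pow]
  have hy : ∑ i, ‖y i‖ ^ 2 = b := by
    simp [y, b, c, apply_ite, ite_pow]
  have ha : 0 ≤ a := Finset.sum_nonneg fun _ _ => by positivity
  have hb : 0 ≤ b := Finset.sum_nonneg fun _ _ => by positivity
  have hψx : ∑ i, conj (ψ i) * x i = (a : ℂ) := by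
    simp [x, a, Complex.conj_mul']
  have hψy : ∑ i, conj (ψ i) * (U *ᵥ y) i = (b : ℂ) := by
    have : ∑ i, conj (ψ i) * (U *ᵥ y) i = star c ⬝ᵥ y := by
      simp only [c]
      rw [Matrix.star_mulVec, Matrix.conjTranspose_conjTranspose, ← Matrix.dotProduct_mulVec]
      rfl
    rw [this]
    simp [dotProduct, y, b, c, Complex.conj_mul']
  have hcs := norm_sum_conj_mul_sq_le ψ (x + U *ᵥ y)
  have hsum : ∑ i, conj (ψ i) * (x + U *ᵥ y) i = ((a + b : ℝ) : ℂ) := by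
    simp only [Pi.add_apply, mul_add, Finset.sum_add_distrib, hψx, hψy, Complex.ofReal_add]
  rw [hsum, Complex.norm_real, Real.norm_of_nonneg (add_nonneg ha hb)] at hcs
  have hcross : ‖∑ i, conj (x i) * (U *ᵥ y) i‖ ≤ s * (√a * √b) := by
    have := norm_sum_conj_mul_mulVec_le_mul_sqrt hU (I := I) (J := J) (x := x) (y := y)
      (fun i hi => by simp [x, hi]) (fun j hj => by simp [y, hj])
    rwa [hx, hy] at this
  have hexp : ∑ i, ‖(x + U *ᵥ y) i‖ ^ 2 =
      a + b + 2 * (∑ i, conj (x i) * (U *ᵥ y) i).re := by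
    have hb' := sum_norm_sq_mulVec hU y
    rw [hy] at hb'
    rw [← hx, ← hb', Complex.re_sum, Finset.mul_sum, ← Finset.sum_add_distrib,
      ← Finset.sum_add_distrib]
    refine Finset.sum_congr rfl fun i _ => ?_
    simp only [Pi.add_apply, Complex.sq_norm, Complex.normSq_apply, Complex.add_re,
      Complex.add_im, Complex.mul_re, Complex.conj_re, Complex.conj_im]
    ring
  have hre := (Complex.re_le_norm _).trans hcross
  have hamgm : 2 * (√a * √b) ≤ a + b := by
    nlinarith [sq_nonneg (√a - √b), Real.sq_sqrt ha, Real.sq_sqrt hb]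
  have hv : ∑ i, ‖(x + U *ᵥ y) i‖ ^ 2 ≤ (1 + s) * (a + b) := by
    rw [hexp]
    nlinarith [mul_le_mul_of_nonneg_left hamgm hs]
  have hn : 0 ≤ ∑ i, ‖ψ i‖ ^ 2 := Finset.sum_nonneg fun _ _ => by positivity
  have hfin : (a + b) ^ 2 ≤ ((1 + s) * ∑ i, ‖ψ i‖ ^ 2) * (a + b) :=
    hcs.trans ((mul_le_mul_of_nonneg_left hv hn).trans (le_of_eq (by ring)))
  rcases (add_nonneg ha hb).eq_or_lt with h | h
  · rw [← h]; positivity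
  · rw [sq] at hfin
    exact le_of_mul_le_mul_right hfin h

lemma subOpNorm_le_sCoef (hU : U ∈ Matrix.unitaryGroup (Fin d) ℂ) {I J : Finset (Fin d)} {k : ℕ}
    (hI : I.Nonempty) (hJ : J.Nonempty) (h : I.card + J.card = k + 1) :
    subOpNorm U I J ≤ sCoef U k := by
  refine le_csSup ⟨1, ?_⟩ ⟨I, J, hI, hJ, h, rfl⟩
  rintro _ ⟨I, J, -, -, -, rfl⟩
  exact subOpNorm_le_one hU I J

lemma sCoef_nonneg (U : Matrix (Fin d) (Fin d) ℂ) (k : ℕ) : 0 ≤ sCoef U k := by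
  refine Real.sSup_nonneg ?_
  rintro _ ⟨I, J, -, -, -, rfl⟩
  exact subOpNorm_nonneg U I J

lemma sCoef_le_one (hU : U ∈ Matrix.unitaryGroup (Fin d) ℂ) (k : ℕ) : sCoef U k ≤ 1 := by
  refine Real.sSup_le ?_ zero_le_one
  rintro _ ⟨I, J, -, -, -, rfl⟩
  exact subOpNorm_le_one hU I J

lemma sCoef_zero (U : Matrix (Fin d) (Fin d) ℂ) : sCoef U 0 = 0 := by
  refine le_antisymm (Real.sSup_le ?_ le_rfl) (sCoef_nonneg U 0)
  rintro _ ⟨I, J, hI, hJ, h, -⟩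
  have := hI.card_pos
  have := hJ.card_pos
  omega

lemma sCoef_le_succ (hU : U ∈ Matrix.unitaryGroup (Fin d) ℂ) {k : ℕ} (hk : k < d) :
    sCoef U k ≤ sCoef U (k + 1) := by
  refine Real.sSup_le ?_ (sCoef_nonneg U _)
  rintro _ ⟨I, J, hI, hJ, h, rfl⟩
  have hIc : I.card < (Finset.univ : Finset (Fin d)).card := by
    have := hJ.card_pos
    rw [Finset.card_fin]
    omega
  obtain ⟨i, -, hi⟩ := Finset.exists_mem_notMem_of_card_lt_card hIc
  refine (subOpNorm_mono hU (Finset.subset_insert i I) subset_rfl).trans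
    (subOpNorm_le_sCoef hU (Finset.insert_nonempty i I) hJ ?_)
  rw [Finset.card_insert_of_notMem hi]
  omega

lemma sCoef_eq_one (hU : U ∈ Matrix.unitaryGroup (Fin d) ℂ) (hd : 0 < d) : sCoef U d = 1 := by
  refine le_antisymm (sCoef_le_one hU d) ?_
  let j : Fin d := ⟨0, hd⟩
  have : Nonempty (Fin d) := ⟨j⟩
  refine le_trans ?_ (subOpNorm_le_sCoef hU (I := Finset.univ) (J := {j}) Finset.univ_nonempty
    (Finset.singleton_nonempty j) (by simp))
  let y : Fin d → ℂ := Pi.single j 1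
  have hy : ∑ i, ‖y i‖ ^ 2 = 1 := by
    simp [y, Pi.single_apply, apply_ite, ite_pow]
  have hx : ∑ i, ‖(U *ᵥ y) i‖ ^ 2 = 1 := (sum_norm_sq_mulVec hU y).trans hy
  have h := norm_sum_conj_mul_mulVec_le_subOpNorm hU (I := Finset.univ) (J := {j})
    (x := U *ᵥ y) (y := y) (by simp) (fun i hi => by simp [y, Finset.notMem_singleton.mp hi]) hx hy
  refine le_trans (le_of_eq ?_) h
  have : ∑ i, conj ((U *ᵥ y) i) * (U *ᵥ y) i = ((1 : ℝ) : ℂ) := by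
    rw [← hx, ofReal_sum_norm_sq]; rfl
  rw [this]; simp

open scoped MatrixOrder Matrix.Norms.L2Operator in
lemma exists_eq_conjTranspose_mul_self {ρ : Matrix (Fin d) (Fin d) ℂ} (hρ : ρ.PosSemidef) :
    ∃ B : Matrix (Fin d) (Fin d) ℂ, ρ = Bᴴ * B :=
  CStarAlgebra.nonneg_iff_eq_star_mul_self.mp hρ.nonneg

lemma re_diag_conjTranspose_mul_self (B : Matrix (Fin d) (Fin d) ℂ) (i : Fin d) :
    ((Bᴴ * B) i i).re = ∑ k, ‖B k i‖ ^ 2 := by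
  simp only [Matrix.mul_apply, Matrix.conjTranspose_apply, Complex.re_sum]
  refine Finset.sum_congr rfl fun k _ => ?_
  rw [Complex.star_def, Complex.conj_mul', ← Complex.ofReal_pow, Complex.ofReal_re]

/-- Two-projection bound for a density matrix. -/
lemma sum_re_diag_add_sum_re_diag_le (hU : U ∈ Matrix.unitaryGroup (Fin d) ℂ)
    {ρ : Matrix (Fin d) (Fin d) ℂ} (hρ : ρ.PosSemidef) (I J : Finset (Fin d)) :
    ∑ i ∈ I, (ρ i i).re + ∑ j ∈ J, ((Uᴴ * ρ * U) j j).re ≤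
      (1 + subOpNorm U I J) * ρ.trace.re := by
  obtain ⟨B, rfl⟩ := exists_eq_conjTranspose_mul_self hρ
  have hq : Uᴴ * (Bᴴ * B) * U = (B * U)ᴴ * (B * U) := by
    rw [Matrix.conjTranspose_mul]; simp only [Matrix.mul_assoc]
  have htr : (Bᴴ * B).trace.re = ∑ k, ∑ i, ‖B k i‖ ^ 2 := by
    rw [Finset.sum_comm]
    simp only [Matrix.trace, Matrix.diag_apply, Complex.re_sum, re_diag_conjTranspose_mul_self]
  rw [hq, htr]
  simp only [re_diag_conjTranspose_mul_self]
  rw [Finset.sum_comm, Finset.sum_comm (s := J), ← Finset.sum_add_distrib, Finset.mul_sum]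
  refine Finset.sum_le_sum fun k _ => ?_
  have h := sum_norm_sq_add_sum_norm_sq_le hU I J (star (B k))
  have hc : ∀ j, ‖(Uᴴ *ᵥ star (B k)) j‖ = ‖(B * U) k j‖ := fun j => by
    rw [← Matrix.star_vecMul, Pi.star_apply, norm_star]
    rfl
  simpa [hc] using h

end Unitary

/-- The vector `(1, W₁, …, W_d, 0, 0, …)` as a sequence. -/
noncomputable def extendedW {d : ℕ} (U : Matrix (Fin d) (Fin d) ℂ) : ℕ → ℝ
  | 0 => 1
  | k + 1 => sCoef U (min (k + 1) d) - sCoef U (min k d)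

section ExtendedW

variable {d : ℕ} {U : Matrix (Fin d) (Fin d) ℂ}

lemma sum_range_succ_extendedW (U : Matrix (Fin d) (Fin d) ℂ) (n : ℕ) :
    ∑ i ∈ Finset.range (n + 1), extendedW U i = 1 + sCoef U (min n d) := by
  induction n with
  | zero => simp [extendedW, sCoef_zero]
  | succ n ih => rw [Finset.sum_range_succ, ih, extendedW]; ring

lemma extendedW_nonneg (hU : U ∈ Matrix.unitaryGroup (Fin d) ℂ) (n : ℕ) :
    0 ≤ extendedW U n := by
  cases n with
  | zero => exact zero_le_one
  | succ k =>
    rw [extendedW, sub_nonneg]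
    rcases lt_or_ge k d with h | h
    · rw [min_eq_left h.le, min_eq_left (Nat.succ_le_of_lt h)]
      exact sCoef_le_succ hU h
    · rw [min_eq_right h, min_eq_right (h.trans k.le_succ)]

lemma sum_mul_log_extendedW (hd : 0 < d) (U : Matrix (Fin d) (Fin d) ℂ) :
    ∑ i ∈ Finset.range (d + d), extendedW U i * Real.log (extendedW U i) =
      -shannonEntropy (Wvec U) := by
  obtain ⟨m, rfl⟩ : ∃ m, d = m + 1 := ⟨d - 1, by omega⟩
  rw [show m + 1 + (m + 1) = (m + 1 + m) + 1 by ring, Finset.sum_range_succ',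
    Finset.sum_range_add, shannonEntropy, neg_neg]
  have htail : ∀ x ∈ Finset.range m,
      extendedW U (m + 1 + x + 1) * Real.log (extendedW U (m + 1 + x + 1)) = 0 := by
    intro x _
    rw [extendedW, min_eq_right (by omega), min_eq_right (by omega)]
    simp
  rw [Finset.sum_eq_zero htail, Finset.sum_range]
  have hW : ∀ k : Fin (m + 1), extendedW U (k + 1) = Wvec U k := by
    intro k
    have hk := k.2
    rw [extendedW, Wvec, min_eq_left (by omega), min_eq_left (by omega)]
    split_ifs with h
    · rw [h, sCoef_zero]
    · rfl
  simp only [hW]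
  simp [extendedW]

end ExtendedW

/-- **Direct-sum majorization entropic uncertainty relation (Shannon case)**:
`H(p) + H(q) ≥ H(W)` with `W = (s₁, s₂ - s₁, …, s_d - s_{d-1})`. -/
theorem stmt_6 (d : ℕ) (hd : 2 ≤ d)
    (U : Matrix (Fin d) (Fin d) ℂ) (hU : U ∈ Matrix.unitaryGroup (Fin d) ℂ)
    (ρ : Matrix (Fin d) (Fin d) ℂ) (hρ : ρ.PosSemidef) (hρtr : ρ.trace = 1)
    (p q : Fin d → ℝ)
    (hp : ∀ i, p i = (ρ i i).re)
    (hq : ∀ j, q j = ((Uᴴ * ρ * U) j j).re) :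
    shannonEntropy p + shannonEntropy q ≥ shannonEntropy (Wvec U) := by
  have hd0 : 0 < d := by omega
  have hp0 : ∀ i, 0 ≤ p i := fun i => by
    rw [hp]; exact (Complex.nonneg_iff.mp hρ.diag_nonneg).1
  have hq0 : ∀ j, 0 ≤ q j := fun j => by
    rw [hq]; exact (Complex.nonneg_iff.mp (hρ.conjTranspose_mul_mul_same U).diag_nonneg).1
  have hp1 : ∑ i, p i = 1 := by
    simpa [Matrix.trace, ← hp] using congrArg Complex.re hρtr
  have hq1 : ∑ j, q j = 1 := by
    have h : (Uᴴ * ρ * U).trace = 1 := by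
      rw [Matrix.trace_mul_cycle, show U * Uᴴ = 1 from Matrix.mem_unitaryGroup_iff.mp hU,
        Matrix.one_mul, hρtr]
    simpa [Matrix.trace, ← hq] using congrArg Complex.re h
  have hpS : ∀ I : Finset (Fin d), ∑ i ∈ I, p i ≤ 1 := fun I =>
    hp1 ▸ Finset.sum_le_univ_sum_of_nonneg hp0
  have hqS : ∀ J : Finset (Fin d), ∑ j ∈ J, q j ≤ 1 := fun J =>
    hq1 ▸ Finset.sum_le_univ_sum_of_nonneg hq0
  have hmaj : ∀ s : Finset (Fin d ⊕ Fin d),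
      ∑ i ∈ s, Sum.elim p q i ≤ ∑ i ∈ Finset.range s.card, extendedW U i := by
    intro s
    have hsum : ∑ i ∈ s, Sum.elim p q i = ∑ i ∈ s.toLeft, p i + ∑ j ∈ s.toRight, q j := by
      conv_lhs => rw [← Finset.toLeft_disjSum_toRight (u := s)]
      simp [Finset.sum_disjSum]
    rw [hsum, ← Finset.card_toLeft_add_card_toRight (u := s)]
    generalize s.toLeft = I, s.toRight = J
    rcases I.eq_empty_or_nonempty with rfl | hI
    · rcases J.eq_empty_or_nonempty with rfl | hJ
      · simp
      · obtain ⟨n, hn⟩ := Nat.exists_eq_succ_of_ne_zero hJ.card_pos.ne'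
        rw [Finset.card_empty, zero_add, hn, sum_range_succ_extendedW, Finset.sum_empty]
        linarith [hqS J, sCoef_nonneg U (min n d)]
    · obtain ⟨n, hn⟩ : ∃ n, I.card + J.card = n + 1 :=
        Nat.exists_eq_succ_of_ne_zero (by have := hI.card_pos; omega)
      rw [hn, sum_range_succ_extendedW]
      rcases J.eq_empty_or_nonempty with rfl | hJ
      · rw [Finset.sum_empty]
        linarith [hpS I, sCoef_nonneg U (min n d)]
      rcases le_total n d with h | h
      · have hb := sum_re_diag_add_sum_re_diag_le hU hρ I J
        simp only [← hp, ← hq, hρtr, Complex.one_re, mul_one] at hb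
        rw [min_eq_left h]
        linarith [subOpNorm_le_sCoef hU hI hJ hn]
      · rw [min_eq_right h, sCoef_eq_one hU hd0]
        linarith [hpS I, hqS J]
  have hcard : Fintype.card (Fin d ⊕ Fin d) = d + d := by simp
  have htot : ∑ i ∈ Finset.range (d + d), extendedW U i = 2 := by
    obtain ⟨n, hn⟩ : ∃ n, d + d = n + 1 := Nat.exists_eq_succ_of_ne_zero (by omega)
    rw [hn, sum_range_succ_extendedW, min_eq_right (by omega), sCoef_eq_one hU hd0]
    norm_num
  have key := sum_mul_log_le_of_majorized (z := Sum.elim p q) (w := extendedW U)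
    (by rintro (i | j) <;> simp [hp0, hq0]) (extendedW_nonneg hU) hmaj
    (by rw [hcard, htot, Fintype.sum_sum_type]; simp only [Sum.elim_inl, Sum.elim_inr]
        rw [hp1, hq1]; norm_num)
  rw [hcard, sum_mul_log_extendedW hd0, Fintype.sum_sum_type] at key
  simp only [Sum.elim_inl, Sum.elim_inr] at key
  unfold shannonEntropy at key ⊢
  linarith
end
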